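/- arXiv:1210.1926 — 13 statements merged into one kernel-verified Lean document; each statement's English description precedes it below -/
import Mathlib

section
/- The set K has exactly 12 elements. -/
/-- `F = GF(3)` realized as `ZMod 3`. -/
abbrev F3 := ZMod 3

/-- `PG(5,3)`: the projective space of `F³ ⁶` (projectivization of `Fin 6 → F`). -/
abbrev PG5 := Projectivization F3 (Fin 6 → F3)

/-- `v` is a representative vector of the projective point `Q`. -/
def IsRep6 (v : Fin 6 → F3) (Q : PG5) : Prop :=
  ∃ hv : v ≠ 0, Projectivization.mk F3 v hv = Q

/-- The set `K ⊆ PG(5,3)`. -/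
def Kset : Set PG5 :=
  {Q | ∃ x₀ x₁ x₂ : F3, (x₁, x₂) ≠ (0, 0) ∧
    IsRep6 ![x₀ ^ 2 + 1, x₀ * x₁, x₀ * x₂, x₁ ^ 2, x₁ * x₂, x₂ ^ 2] Q}

/-- The vector of `F⁶` representing the point of `K` with parameters `x₀, x₁, x₂`. -/
def kVec (x : F3 × F3 × F3) : Fin 6 → F3 :=
  ![x.1 ^ 2 + 1, x.1 * x.2.1, x.1 * x.2.2, x.2.1 ^ 2, x.2.1 * x.2.2, x.2.2 ^ 2]

/-- The representative vectors of the points of `K`. -/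
def kVecs : Finset (Fin 6 → F3) :=
  (Finset.univ.filter fun x : F3 × F3 × F3 => x.2 ≠ (0, 0)).image kVec

theorem mem_kVecs {v : Fin 6 → F3} :
    v ∈ kVecs ↔ ∃ x : F3 × F3 × F3, x.2 ≠ (0, 0) ∧ kVec x = v := by
  simp [kVecs]

theorem card_kVecs : kVecs.card = 12 := by
  decide +kernel

theorem ne_zero_of_mem_kVecs {v : Fin 6 → F3} (hv : v ∈ kVecs) : v ≠ 0 := by
  obtain ⟨⟨x₀, x₁, x₂⟩, hx, rfl⟩ := mem_kVecs.1 hv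
  intro h
  have h3 : x₁ ^ 2 = 0 := congrFun h 3
  have h5 : x₂ ^ 2 = 0 := congrFun h 5
  exact hx (Prod.ext (pow_eq_zero_iff two_ne_zero |>.1 h3) (pow_eq_zero_iff two_ne_zero |>.1 h5))

/-- A nonzero pair of squares of `GF(3)` is a scalar multiple of another pair of squares only
for the scalar `1`. -/
theorem eq_one_of_mul_sq_eq_sq : ∀ a x₁ x₂ y₁ y₂ : F3, (x₁, x₂) ≠ (0, 0) →
    a * y₁ ^ 2 = x₁ ^ 2 → a * y₂ ^ 2 = x₂ ^ 2 → a = 1 := by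
  decide +kernel

theorem eq_of_smul_eq_of_mem_kVecs {v w : Fin 6 → F3} (hv : v ∈ kVecs) (hw : w ∈ kVecs)
    {a : F3} (h : a • w = v) : v = w := by
  obtain ⟨⟨x₀, x₁, x₂⟩, hx, rfl⟩ := mem_kVecs.1 hv
  obtain ⟨⟨y₀, y₁, y₂⟩, -, rfl⟩ := mem_kVecs.1 hw
  have ha : a = 1 := eq_one_of_mul_sq_eq_sq a x₁ x₂ y₁ y₂ hx (congrFun h 3) (congrFun h 5)
  rw [← h, ha, one_smul]

/-- The point of `PG(5,3)` spanned by a representative vector. -/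
def kPoint (v : kVecs) : PG5 :=
  Projectivization.mk F3 v.1 (ne_zero_of_mem_kVecs v.2)

theorem kPoint_injective : Function.Injective kPoint := by
  intro v w h
  obtain ⟨a, ha⟩ := (Projectivization.mk_eq_mk_iff' F3 _ _ _ _).1 h
  exact Subtype.ext (eq_of_smul_eq_of_mem_kVecs v.2 w.2 ha)

theorem Kset_eq_range_kPoint : Kset = Set.range kPoint := by
  ext Q
  constructor
  · rintro ⟨x₀, x₁, x₂, hx, hv, rfl⟩
    exact ⟨⟨kVec (x₀, x₁, x₂), mem_kVecs.2 ⟨_, hx, rfl⟩⟩, rfl⟩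
  · rintro ⟨⟨v, hv⟩, rfl⟩
    obtain ⟨⟨x₀, x₁, x₂⟩, hx, rfl⟩ := mem_kVecs.1 hv
    exact ⟨x₀, x₁, x₂, hx, ne_zero_of_mem_kVecs hv, rfl⟩

/-- The set `K` has exactly 12 elements. -/
theorem Kset_ncard_eq_twelve : Kset.ncard = 12 := by
  rw [Kset_eq_range_kPoint, ← Set.image_univ, Set.ncard_image_of_injective _ kPoint_injective,
    Set.ncard_univ, Nat.card_eq_fintype_card, Fintype.card_coe, card_kVecs]
end

section
/- K is a cap: for any three distinct points of K, any choice of representative vectors v₁, v₂, v₃ ∈ F⁶ is linearly independent (no three points of K are collinear). -/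
/-- The vector whose classes make up `Kset`. -/
def capVec (x₀ x₁ x₂ : F3) : Fin 6 → F3 :=
  ![x₀ ^ 2 + 1, x₀ * x₁, x₀ * x₂, x₁ ^ 2, x₁ * x₂, x₂ ^ 2]

lemma capVec_neg (x₀ x₁ x₂ : F3) : capVec (-x₀) (-x₁) (-x₂) = capVec x₀ x₁ x₂ := by
  simp [capVec]

/-- Over `F3`, two nonzero vectors of the plane with vanishing determinant agree up to sign. -/
lemma F3.eq_or_eq_neg_of_det_eq_zero : ∀ x₁ x₂ y₁ y₂ : F3, (x₁, x₂) ≠ (0, 0) →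
    (y₁, y₂) ≠ (0, 0) → x₁ * y₂ - x₂ * y₁ = 0 →
    (y₁ = x₁ ∧ y₂ = x₂) ∨ (y₁ = -x₁ ∧ y₂ = -x₂) := by
  decide

/-- If a combination of three rank-one binary quadratic forms with nonzero coefficients vanishes,
then the forms are pairwise proportional. -/
lemma det_eq_zero_of_sum_sq_eq_zero {R : Type*} [CommRing R] [IsDomain R]
    {a b c x₁ x₂ y₁ y₂ z₁ z₂ : R} (ha : a ≠ 0) (hb : b ≠ 0) (hc : c ≠ 0)
    (h11 : a * x₁ ^ 2 + b * y₁ ^ 2 + c * z₁ ^ 2 = 0)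
    (h12 : a * (x₁ * x₂) + b * (y₁ * y₂) + c * (z₁ * z₂) = 0)
    (h22 : a * x₂ ^ 2 + b * y₂ ^ 2 + c * z₂ ^ 2 = 0) :
    x₁ * y₂ - x₂ * y₁ = 0 ∧ x₁ * z₂ - x₂ * z₁ = 0 := by
  have hx : b * (x₁ * y₂ - x₂ * y₁) ^ 2 + c * (x₁ * z₂ - x₂ * z₁) ^ 2 = 0 := by
    linear_combination x₁ ^ 2 * h22 - 2 * x₁ * x₂ * h12 + x₂ ^ 2 * h11
  have hy : a * (x₁ * y₂ - x₂ * y₁) ^ 2 + c * (y₁ * z₂ - y₂ * z₁) ^ 2 = 0 := by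
    linear_combination y₁ ^ 2 * h22 - 2 * y₁ * y₂ * h12 + y₂ ^ 2 * h11
  have hxy : c * ((x₁ * z₂ - x₂ * z₁) * (y₁ * z₂ - y₂ * z₁)) = 0 := by
    linear_combination x₁ * y₁ * h22 - (x₁ * y₂ + x₂ * y₁) * h12 + x₂ * y₂ * h11
  rcases mul_eq_zero.1 ((mul_eq_zero.1 hxy).resolve_left hc) with h | h
  · simp_all
  · simp_all

lemma capVec_eq_of_sum_eq_zero {a b c x₀ x₁ x₂ y₀ y₁ y₂ z₀ z₁ z₂ : F3}
    (ha : a ≠ 0) (hb : b ≠ 0) (hc : c ≠ 0) (hx : (x₁, x₂) ≠ (0, 0)) (hy : (y₁, y₂) ≠ (0, 0))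
    (hz : (z₁, z₂) ≠ (0, 0))
    (h : a • capVec x₀ x₁ x₂ + b • capVec y₀ y₁ y₂ + c • capVec z₀ z₁ z₂ = 0) :
    capVec x₀ x₁ x₂ = capVec y₀ y₁ y₂ := by
  have aux : ∀ a b c x₀ y₀ z₀ t : F3, a ≠ 0 → b ≠ 0 → c ≠ 0 → t ≠ 0 →
      a * t ^ 2 + b * t ^ 2 + c * t ^ 2 = 0 →
      a * (x₀ * t) + b * (y₀ * t) + c * (z₀ * t) = 0 →
      a * (x₀ ^ 2 + 1) + b * (y₀ ^ 2 + 1) + c * (z₀ ^ 2 + 1) = 0 → x₀ = y₀ := by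
    intro a b c x y z t ha hb hc ht h₁ h₂ h₃
    have coeffs : ∀ a b c : F3, a ≠ 0 → b ≠ 0 → c ≠ 0 → a + b + c = 0 → b = a ∧ c = a := by
      decide
    have sums : ∀ x y z : F3, x + y + z = 0 → x ^ 2 + 1 + (y ^ 2 + 1) + (z ^ 2 + 1) = 0 →
        x = y := by
      decide
    have hs : a + b + c = 0 := by
      refine (mul_eq_zero.1 ?_).resolve_right (pow_ne_zero 2 ht)
      linear_combination h₁
    obtain ⟨rfl, rfl⟩ := coeffs a b c ha hb hc hs
    refine sums x y z (mul_left_cancel₀ (mul_ne_zero ha ht) ?_) (mul_left_cancel₀ ha ?_)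
    · linear_combination h₂
    · linear_combination h₃
  have key : ∀ y₀ z₀ : F3,
      a • capVec x₀ x₁ x₂ + b • capVec y₀ x₁ x₂ + c • capVec z₀ x₁ x₂ = 0 → x₀ = y₀ := by
    intro y₀ z₀ h
    have h0 := congrFun h 0
    by_cases hx1 : x₁ = 0
    · have hx2 : x₂ ≠ 0 := by rintro rfl; exact hx (by rw [hx1])
      exact aux a b c x₀ y₀ z₀ x₂ ha hb hc hx2 (congrFun h 5) (congrFun h 2) h0
    · exact aux a b c x₀ y₀ z₀ x₁ ha hb hc hx1 (congrFun h 3) (congrFun h 1) h0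
  obtain ⟨dy, dz⟩ := det_eq_zero_of_sum_sq_eq_zero ha hb hc (congrFun h 3 :) (congrFun h 4 :)
    (congrFun h 5 :)
  have sign : ∀ w₀ w₁ w₂ : F3, (w₁, w₂) ≠ (0, 0) → x₁ * w₂ - x₂ * w₁ = 0 →
      ∃ w, capVec w₀ w₁ w₂ = capVec w x₁ x₂ := by
    intro w₀ w₁ w₂ hw hd
    rcases F3.eq_or_eq_neg_of_det_eq_zero x₁ x₂ w₁ w₂ hx hw hd with ⟨rfl, rfl⟩ | ⟨rfl, rfl⟩
    · exact ⟨w₀, rfl⟩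
    · exact ⟨-w₀, by rw [← capVec_neg, neg_neg, neg_neg]⟩
  obtain ⟨y, ey⟩ := sign y₀ y₁ y₂ hy dy
  obtain ⟨z, ez⟩ := sign z₀ z₁ z₂ hz dz
  rw [ey, ez] at h
  rw [ey, key y z h]

lemma IsRep6.eq_of_smul_add_smul_eq_zero {u v : Fin 6 → F3} {Q R : PG5} (hu : IsRep6 u Q)
    (hv : IsRep6 v R) {a b : F3} (ha : a ≠ 0) (h : a • u + b • v = 0) : Q = R := by
  obtain ⟨hu0, rfl⟩ := hu
  obtain ⟨hv0, rfl⟩ := hv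
  rw [Projectivization.mk_eq_mk_iff']
  refine ⟨-(a⁻¹ * b), ?_⟩
  rw [neg_smul, mul_smul, eq_neg_of_add_eq_zero_right h, smul_neg, inv_smul_smul₀ ha, neg_neg]

lemma IsRep6.exists_eq_smul {u v : Fin 6 → F3} {Q : PG5} (hu : IsRep6 u Q) (hv : IsRep6 v Q) :
    ∃ a : F3, a ≠ 0 ∧ u = a • v := by
  obtain ⟨hu0, rfl⟩ := hu
  obtain ⟨hv0, h⟩ := hv
  obtain ⟨a, rfl⟩ := (Projectivization.mk_eq_mk_iff' _ _ _ _ _).1 h.symm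
  exact ⟨a, by rintro rfl; simp at hu0, rfl⟩

/-- `K` is a cap: for any three distinct points of `K`, any choice of
representative vectors `v₁, v₂, v₃ ∈ F⁶` is linearly independent. -/
theorem Kset_is_cap :
    ∀ Q₁ Q₂ Q₃ : PG5, Q₁ ∈ Kset → Q₂ ∈ Kset → Q₃ ∈ Kset →
      Q₁ ≠ Q₂ → Q₁ ≠ Q₃ → Q₂ ≠ Q₃ →
      ∀ v₁ v₂ v₃ : Fin 6 → F3, IsRep6 v₁ Q₁ → IsRep6 v₂ Q₂ → IsRep6 v₃ Q₃ →
        LinearIndependent F3 ![v₁, v₂, v₃] := by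
  rintro Q₁ Q₂ Q₃ ⟨x₀, x₁, x₂, hx, rx⟩ ⟨y₀, y₁, y₂, hy, ry⟩ ⟨z₀, z₁, z₂, hz, rz⟩ h12 h13 h23
    v₁ v₂ v₃ r₁ r₂ r₃
  obtain ⟨l, hl, e₁⟩ := r₁.exists_eq_smul rx
  obtain ⟨m, hm, e₂⟩ := r₂.exists_eq_smul ry
  obtain ⟨n, hn, e₃⟩ := r₃.exists_eq_smul rz
  rw [Fintype.linearIndependent_iff]
  intro g hg
  have h : g 0 • v₁ + g 1 • v₂ + g 2 • v₃ = 0 := by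
    simpa [Fin.sum_univ_three] using hg
  have hzero : g 0 = 0 ∨ g 1 = 0 ∨ g 2 = 0 := by
    by_contra! hne
    obtain ⟨ha, hb, hc⟩ := hne
    rw [e₁, e₂, e₃, smul_smul, smul_smul, smul_smul] at h
    have e := capVec_eq_of_sum_eq_zero (mul_ne_zero ha hl) (mul_ne_zero hb hm)
      (mul_ne_zero hc hn) hx hy hz h
    refine h12 (rx.eq_of_smul_add_smul_eq_zero ry (a := 1) (b := -1) one_ne_zero ?_)
    change (1 : F3) • capVec x₀ x₁ x₂ + (-1 : F3) • capVec y₀ y₁ y₂ = 0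
    rw [e]
    simp
  have pair : ∀ {u v : Fin 6 → F3} {Q R : PG5} {a b : F3}, IsRep6 u Q → IsRep6 v R → Q ≠ R →
      a • u + b • v = 0 → a = 0 ∧ b = 0 := by
    intro u v Q R a b hu hv hne hab
    refine ⟨?_, ?_⟩ <;> by_contra h0
    · exact hne (hu.eq_of_smul_add_smul_eq_zero hv h0 hab)
    · exact hne (hv.eq_of_smul_add_smul_eq_zero hu h0 (by rwa [add_comm])).symm
  have all : g 0 = 0 ∧ g 1 = 0 ∧ g 2 = 0 := by
    rcases hzero with h0 | h0 | h0
    · rw [h0, zero_smul, zero_add] at h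
      exact ⟨h0, pair r₂ r₃ h23 h⟩
    · rw [h0, zero_smul, add_zero] at h
      obtain ⟨p, q⟩ := pair r₁ r₃ h13 h
      exact ⟨p, h0, q⟩
    · rw [h0, zero_smul, add_zero] at h
      obtain ⟨p, q⟩ := pair r₁ r₂ h12 h
      exact ⟨p, q, h0⟩
  intro i
  fin_cases i
  exacts [all.1, all.2.1, all.2.2]
end

section
/- No four points of K are coplanar: for any four distinct points of K, their representative vectors span a subspace of F⁶ of dimension 4. -/
/-- The twelve vectors representing the points of `K`, grouped by the value of `(x₁ : x₂)`. -/
def kColumn : Fin 12 → Fin 6 → F3 :=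
  ![![1, 0, 0, 1, 0, 0], ![2, 1, 0, 1, 0, 0], ![2, 2, 0, 1, 0, 0],
    ![1, 0, 0, 0, 0, 1], ![2, 0, 1, 0, 0, 1], ![2, 0, 2, 0, 0, 1],
    ![1, 0, 0, 1, 1, 1], ![2, 1, 1, 1, 1, 1], ![2, 2, 2, 1, 1, 1],
    ![1, 0, 0, 1, 2, 1], ![2, 1, 2, 1, 2, 1], ![2, 2, 1, 1, 2, 1]]

theorem exists_kColumn_eq : ∀ x₀ x₁ x₂ : F3, (x₁, x₂) ≠ (0, 0) →
    ∃ k, kColumn k = ![x₀ ^ 2 + 1, x₀ * x₁, x₀ * x₂, x₁ ^ 2, x₁ * x₂, x₂ ^ 2] := by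
  decide +kernel

/-- The linear relation among the vectors `kColumn` with prescribed values at six positions. -/
def kRelation (a₀ c₁ c₂ d₀ d₁ d₂ : F3) : Fin 12 → F3 :=
  let s := d₀ + d₁ + d₂
  let p := -(c₁ - c₂) - (d₁ - d₂)
  let q := -(c₁ - c₂) + (d₁ - d₂)
  let c₀ := s - c₁ - c₂
  let a₁ := -(s - a₀ + p)
  let a₂ := -(s - a₀ - p)
  let b₀ := -s + ((a₀ - a₁ - a₂) + (c₀ - c₁ - c₂) + (d₀ - d₁ - d₂))
  let b₁ := -(s - b₀ + q)
  let b₂ := -(s - b₀ - q)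
  ![a₀, a₁, a₂, b₀, b₁, b₂, c₀, c₁, c₂, d₀, d₁, d₂]

theorem eq_kRelation_of_sum_smul_eq_zero {c : Fin 12 → F3} (hc : ∑ k, c k • kColumn k = 0) :
    c = kRelation (c 0) (c 7) (c 8) (c 9) (c 10) (c 11) := by
  have h (i : Fin 6) := congrFun hc i
  have h₀ := h 0
  have h₁ := h 1
  have h₂ := h 2
  have h₃ := h 3
  have h₄ := h 4
  have h₅ := h 5
  simp [Fin.sum_univ_succ, kColumn] at h₀ h₁ h₂ h₃ h₄ h₅
  funext k
  fin_cases k <;> simp [kRelation] <;> grind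

theorem kRelation_eq_zero_of_card_support_le : ∀ a₀ c₁ c₂ d₀ d₁ d₂ : F3,
    (Finset.univ.filter fun k => kRelation a₀ c₁ c₂ d₀ d₁ d₂ k ≠ 0).card ≤ 4 →
      kRelation a₀ c₁ c₂ d₀ d₁ d₂ = 0 := by
  decide +kernel

theorem linearIndependent_kColumn_comp {k : Fin 4 → Fin 12} (hk : Function.Injective k) :
    LinearIndependent F3 fun i => kColumn (k i) := by
  rw [Fintype.linearIndependent_iff]
  intro g hg i
  set c : Fin 12 → F3 := Function.extend k g 0 with hcdef
  have hsupp (m : Fin 12) (hm : m ∉ Finset.univ.image k) : c m = 0 :=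
    Function.extend_apply' _ _ _ fun ⟨j, hj⟩ => hm (by simp [← hj])
  have hsum : ∑ m, c m • kColumn m = 0 := by
    rw [← Finset.sum_subset (Finset.subset_univ (Finset.univ.image k))
      fun m _ hm => by rw [hsupp m hm, zero_smul], Finset.sum_image hk.injOn, ← hg]
    simp only [hcdef, hk.extend_apply]
  have hcard : (Finset.univ.filter fun m => c m ≠ 0).card ≤ 4 := by
    refine (Finset.card_le_card (t := Finset.univ.image k) fun m hm => ?_).trans
      (Finset.card_image_le.trans (by simp))
    by_contra hm'
    exact (Finset.mem_filter.1 hm).2 (hsupp m hm')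
  have hrel := eq_kRelation_of_sum_smul_eq_zero hsum
  have hzero : c = 0 := by
    rw [hrel] at hcard ⊢
    exact kRelation_eq_zero_of_card_support_le _ _ _ _ _ _ hcard
  rw [← hk.extend_apply g 0 i, ← hcdef, hzero, Pi.zero_apply]

/-- No four points of `K` are coplanar: for any four distinct points of
`K`, their representative vectors span a subspace of `F⁶` of dimension 4. -/
theorem Kset_no_four_points_coplanar :
    ∀ Q : Fin 4 → PG5, (∀ i, Q i ∈ Kset) → Function.Injective Q →
      ∀ v : Fin 4 → (Fin 6 → F3), (∀ i, IsRep6 (v i) (Q i)) →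
        Module.finrank F3 (Submodule.span F3 (Set.range v)) = 4 := by
  intro Q hQ hinj v hv
  have key (i : Fin 4) : ∃ (k : Fin 12) (a : F3ˣ), v i = a • kColumn k ∧
      ∃ hk : kColumn k ≠ 0, Projectivization.mk F3 (kColumn k) hk = Q i := by
    obtain ⟨x₀, x₁, x₂, hx, hw, hwQ⟩ := hQ i
    obtain ⟨k, hk⟩ := exists_kColumn_eq x₀ x₁ x₂ hx
    obtain ⟨hvi, hviQ⟩ := hv i
    obtain ⟨a, ha⟩ := (Projectivization.mk_eq_mk_iff F3 _ _ hvi hw).1 (hviQ.trans hwQ.symm)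
    exact ⟨k, a, by rw [hk, ha], by rwa [hk], by simp only [hk, hwQ]⟩
  choose k a hva hk hkQ using key
  have hkinj : Function.Injective k := by
    intro i j hij
    apply hinj
    rw [← hkQ i, ← hkQ j]
    simp only [hij]
  have hli : LinearIndependent F3 v := by
    have h := (linearIndependent_kColumn_comp hkinj).units_smul a
    convert h using 1
    funext i
    exact hva i
  simpa using finrank_span_eq_card hli
end

section
/- For all x₀, x₁, x₂ ∈ F with (x₁, x₂) ≠ (0,0) and all a₀, a₁, a₂ ∈ F with a₀ ≠ 0, one has a₀²·(x₀²+1) + 2a₀a₁·x₀x₁ + 2a₀a₂·x₀x₂ + a₁²·x₁² + 2a₁a₂·x₁x₂ + a₂²·x₂² ≠ 0. (Equivalently: no point of K lies in any osculating prime of the Veronese surface along a conic not passing through P.) -/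
/-- `-1` is not a square in `F`, so a sum of two squares vanishes only trivially. -/
theorem sq_add_sq_ne_zero_of_right_ne_zero :
    ∀ s a : F3, a ≠ 0 → s ^ 2 + a ^ 2 ≠ 0 := by
  decide

/-- For all `x₀, x₁, x₂ ∈ F` with `(x₁, x₂) ≠ (0,0)` and all
`a₀, a₁, a₂ ∈ F` with `a₀ ≠ 0`, one has
`a₀²(x₀²+1) + 2a₀a₁x₀x₁ + 2a₀a₂x₀x₂ + a₁²x₁² + 2a₁a₂x₁x₂ + a₂²x₂² ≠ 0`.
(No point of `K` lies in any osculating prime of the Veronese surface along a conic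
not passing through `P`.) -/
theorem Kset_avoids_osculating_primes :
    ∀ x₀ x₁ x₂ a₀ a₁ a₂ : F3, (x₁, x₂) ≠ (0, 0) → a₀ ≠ 0 →
      a₀ ^ 2 * (x₀ ^ 2 + 1) + 2 * a₀ * a₁ * (x₀ * x₁) + 2 * a₀ * a₂ * (x₀ * x₂) +
        a₁ ^ 2 * x₁ ^ 2 + 2 * a₁ * a₂ * (x₁ * x₂) + a₂ ^ 2 * x₂ ^ 2 ≠ 0 := by
  intro x₀ x₁ x₂ a₀ a₁ a₂ _ ha₀
  convert sq_add_sq_ne_zero_of_right_ne_zero (a₀ * x₀ + a₁ * x₁ + a₂ * x₂) a₀ ha₀ using 1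
  ring
end

section
/- There are exactly 12 five-dimensional F-subspaces W of F⁶ such that no point of K has a representative vector lying in W; that is, exactly twelve hyperplanes of PG(5,3) carry no point of K. -/
/-- The vector `(x₀² + 1, x₀x₁, x₀x₂, x₁², x₁x₂, x₂²)` representing a point of `K`. -/
def kvec (x₀ x₁ x₂ : F3) : Fin 6 → F3 :=
  ![x₀ ^ 2 + 1, x₀ * x₁, x₀ * x₂, x₁ ^ 2, x₁ * x₂, x₂ ^ 2]

theorem kvec_ne_zero {x₀ x₁ x₂ : F3} (h : (x₁, x₂) ≠ (0, 0)) : kvec x₀ x₁ x₂ ≠ 0 := by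
  intro h0
  have h3 : x₁ ^ 2 = 0 := congrFun h0 3
  have h5 : x₂ ^ 2 = 0 := congrFun h0 5
  exact h (by rw [pow_eq_zero_iff two_ne_zero |>.1 h3, pow_eq_zero_iff two_ne_zero |>.1 h5])

/-- A subspace carries no point of `K` iff it contains none of the vectors `kvec`. -/
theorem avoids_Kset_iff (W : Submodule F3 (Fin 6 → F3)) :
    (∀ Q ∈ Kset, ∀ v : Fin 6 → F3, IsRep6 v Q → v ∉ W) ↔
      ∀ x₀ x₁ x₂ : F3, (x₁, x₂) ≠ (0, 0) → kvec x₀ x₁ x₂ ∉ W := by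
  constructor
  · intro H x₀ x₁ x₂ hx
    have hrep : IsRep6 (kvec x₀ x₁ x₂) (Projectivization.mk F3 _ (kvec_ne_zero hx)) :=
      ⟨kvec_ne_zero hx, rfl⟩
    exact H _ ⟨x₀, x₁, x₂, hx, hrep⟩ _ hrep
  · rintro H Q ⟨x₀, x₁, x₂, hx, hk, rfl⟩ v ⟨hv, hvQ⟩ hvW
    obtain ⟨c, hc⟩ := (Projectivization.mk_eq_mk_iff F3 _ _ hk hv).1 hvQ.symm
    refine H x₀ x₁ x₂ hx ?_
    rw [kvec, ← hc]
    exact W.smul_mem (c : F3) hvW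

/-- The linear form with coefficient vector `a` vanishes at no vector `kvec`. -/
def AvoidsKvec (a : Fin 6 → F3) : Prop :=
  ∀ x₀ x₁ x₂ : F3, (x₁, x₂) ≠ (0, 0) → a ⬝ᵥ kvec x₀ x₁ x₂ ≠ 0

instance : DecidablePred AvoidsKvec := fun a => by
  unfold AvoidsKvec; infer_instance

/-- Normalization of a coefficient vector: a choice of one of `a` and `-a`. -/
def IsNormalized (a : Fin 6 → F3) : Prop :=
  a 0 = 1 ∨ a 0 = 0 ∧ a 3 = 1

instance : DecidablePred IsNormalized := fun a => by
  unfold IsNormalized; infer_instance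

/-- The normalized coefficient vectors of linear forms without zeros on `K`. -/
def normalizedForms : Finset (Fin 6 → F3) :=
  Finset.univ.filter fun a => IsNormalized a ∧ AvoidsKvec a

theorem card_normalizedForms : normalizedForms.card = 12 := by
  decide +kernel

theorem AvoidsKvec.neg {a : Fin 6 → F3} (h : AvoidsKvec a) : AvoidsKvec (-a) := by
  intro x₀ x₁ x₂ hx
  rw [neg_dotProduct]
  exact neg_ne_zero.2 (h x₀ x₁ x₂ hx)

/-- Evaluating at `(0, 1, 0)` shows `a 0 + a 3 ≠ 0`, so `a` or `-a` is normalized. -/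
theorem AvoidsKvec.isNormalized_or_neg {a : Fin 6 → F3} (h : AvoidsKvec a) :
    IsNormalized a ∨ IsNormalized (-a) := by
  have h3 := h 0 1 0 (by decide)
  simp only [kvec, dotProduct, Fin.sum_univ_six] at h3
  have key : ∀ s t : F3, s + t ≠ 0 →
      (s = 1 ∨ s = 0 ∧ t = 1) ∨ (-s = 1 ∨ -s = 0 ∧ -t = 1) := by decide
  exact key (a 0) (a 3) (by simpa using h3)

theorem IsNormalized.eq_one_of_smul {a : Fin 6 → F3} {c : F3} (ha : IsNormalized a)
    (hca : IsNormalized (c • a)) : c = 1 := by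
  have key : ∀ c s t : F3, (s = 1 ∨ s = 0 ∧ t = 1) →
      (c * s = 1 ∨ c * s = 0 ∧ c * t = 1) → c = 1 := by decide
  exact key c (a 0) (a 3) ha hca

theorem IsNormalized.ne_zero {a : Fin 6 → F3} (ha : IsNormalized a) : a ≠ 0 := by
  rintro rfl
  simp [IsNormalized] at ha

/-- The kernel of the linear form with coefficient vector `a`. -/
def formKer (a : Fin 6 → F3) : Submodule F3 (Fin 6 → F3) :=
  LinearMap.ker (dotProductEquiv F3 (Fin 6) a)

theorem mem_formKer {a v : Fin 6 → F3} : v ∈ formKer a ↔ a ⬝ᵥ v = 0 := Iff.rfl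

theorem formKer_neg (a : Fin 6 → F3) : formKer (-a) = formKer a := by
  ext v
  simp [mem_formKer]

theorem finrank_formKer {a : Fin 6 → F3} (ha : a ≠ 0) : Module.finrank F3 (formKer a) = 5 := by
  have h := Module.Dual.finrank_ker_add_one_of_ne_zero
    (f := dotProductEquiv F3 (Fin 6) a) (by simpa using ha)
  rw [Module.finrank_fin_fun] at h
  exact Nat.succ_injective h

theorem exists_eq_formKer {W : Submodule F3 (Fin 6 → F3)} (hW : Module.finrank F3 W = 5) :
    ∃ a : Fin 6 → F3, W = formKer a := by
  have hlt : W < ⊤ := by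
    rw [lt_top_iff_ne_top]
    rintro rfl
    simp at hW
  obtain ⟨f, hf, hle⟩ := Submodule.exists_le_ker_of_lt_top W hlt
  obtain ⟨a, rfl⟩ := (dotProductEquiv F3 (Fin 6)).surjective f
  have ha : a ≠ 0 := by simpa using hf
  exact ⟨a, Submodule.eq_of_le_of_finrank_eq hle (hW.trans (finrank_formKer ha).symm)⟩

theorem exists_smul_eq_of_formKer_le {a b : Fin 6 → F3} (h : formKer a ≤ formKer b) :
    ∃ c : F3, c • a = b := by
  have hmem := mem_span_of_iInf_ker_le_ker (L := fun _ : Unit => dotProductEquiv F3 (Fin 6) a)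
    (K := dotProductEquiv F3 (Fin 6) b) (by simpa [formKer] using h)
  rw [Set.range_const, Submodule.mem_span_singleton] at hmem
  obtain ⟨c, hc⟩ := hmem
  exact ⟨c, (dotProductEquiv F3 (Fin 6)).injective (by rw [map_smul, hc])⟩

theorem formKer_injOn : Set.InjOn formKer {a | IsNormalized a} := by
  intro a ha b hb hab
  obtain ⟨c, rfl⟩ := exists_smul_eq_of_formKer_le hab.le
  rw [ha.eq_one_of_smul hb, one_smul]

/-- The hyperplanes without points of `K` are the kernels of the normalized forms. -/
theorem setOf_avoids_Kset_eq_image :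
    {W : Submodule F3 (Fin 6 → F3) | Module.finrank F3 W = 5 ∧
      ∀ Q ∈ Kset, ∀ v : Fin 6 → F3, IsRep6 v Q → v ∉ W} = formKer '' normalizedForms := by
  ext W
  simp only [Set.mem_ofPred_eq, avoids_Kset_iff, Set.mem_image, Finset.mem_coe, normalizedForms,
    Finset.mem_filter_univ]
  constructor
  · rintro ⟨hW, H⟩
    obtain ⟨a, rfl⟩ := exists_eq_formKer hW
    have ha : AvoidsKvec a := H
    rcases ha.isNormalized_or_neg with hn | hn
    · exact ⟨a, ⟨hn, ha⟩, rfl⟩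
    · exact ⟨-a, ⟨hn, ha.neg⟩, formKer_neg a⟩
  · rintro ⟨a, ⟨hn, ha⟩, rfl⟩
    exact ⟨finrank_formKer hn.ne_zero, ha⟩

/-- There are exactly 12 five-dimensional `F`-subspaces `W` of `F⁶` such
that no point of `K` has a representative vector lying in `W`; i.e. exactly twelve
hyperplanes of `PG(5,3)` carry no point of `K`. -/
theorem twelve_hyperplanes_avoid_Kset :
    {W : Submodule F3 (Fin 6 → F3) | Module.finrank F3 W = 5 ∧
      ∀ Q ∈ Kset, ∀ v : Fin 6 → F3, IsRep6 v Q → v ∉ W}.ncard = 12 := by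
  rw [setOf_avoids_Kset_eq_image, Set.InjOn.ncard_image, Set.ncard_coe_finset,
    card_normalizedForms]
  exact formKer_injOn.mono fun a ha => (Finset.mem_filter.1 ha).2.1
end

section
/- For each k ∈ F ∪ {∞}, the conic m_k := Δ_{k,0} ∪ {P} consists of 4 points whose representative vectors span a 3-dimensional subspace π_k of F⁶ (the conic plane), and Δ_{k,1} equals the set of internal points of m_k, i.e. the set of points [v] with v ∈ π_k that lie on no line of the plane π_k meeting m_k in exactly one point. Consequently K = ⋃_k Δ_{k,1} is exactly the union of the internal points of the four conics of the Veronese surface through P. -/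
/-- For `k ∈ F ∪ {∞}` (with `none` playing the role of `∞`), the pair
`(a_k, b_k) := (1, k)` for `k ∈ F` and `(a_∞, b_∞) := (0, 1)`. -/
def abk : Option F3 → F3 × F3
  | some k => (1, k)
  | none => (0, 1)

/-- The set `Δ_{k,j} = { [(u²+j, u·a_k, u·b_k, a_k², a_k·b_k, b_k²)] : u ∈ F }`. -/
def Δ (k : Option F3) (j : F3) : Set PG5 :=
  {Q | ∃ u : F3,
    IsRep6 ![u ^ 2 + j, u * (abk k).1, u * (abk k).2,
      (abk k).1 ^ 2, (abk k).1 * (abk k).2, (abk k).2 ^ 2] Q}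

/-- The point `P = [(1,0,0,0,0,0)]` of the Veronese surface. -/
def Ppt : PG5 := Projectivization.mk F3 ![1, 0, 0, 0, 0, 0] (by decide)

/-- The conic `m_k := Δ_{k,0} ∪ {P}`. -/
def conicK (k : Option F3) : Set PG5 := Δ k 0 ∪ {Ppt}

/-- The conic plane `π_k`: the subspace of `F⁶` spanned by the representative
vectors of the points of `m_k`. -/
def planeK (k : Option F3) : Submodule F3 (Fin 6 → F3) :=
  Submodule.span F3 {v | ∃ Q ∈ conicK k, IsRep6 v Q}

/-- Coordinates on the conic plane `π_k`: `(x, y, z)` is sent to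
`(x, y a_k, y b_k, z a_k², z a_k b_k, z b_k²)`. -/
def planeMap (k : Option F3) : F3 × F3 × F3 →ₗ[F3] (Fin 6 → F3) where
  toFun w := ![w.1, w.2.1 * (abk k).1, w.2.1 * (abk k).2,
    w.2.2 * (abk k).1 ^ 2, w.2.2 * ((abk k).1 * (abk k).2), w.2.2 * (abk k).2 ^ 2]
  map_add' v w := by
    ext i
    fin_cases i <;> simp [add_mul]
  map_smul' c w := by
    ext i
    fin_cases i <;> simp [mul_assoc]

/-- The quadratic form `xz - y²` whose zeros in the plane `π_k` are the points of `m_k`. -/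
def conicForm (w : F3 × F3 × F3) : F3 := w.1 * w.2.2 - w.2.1 ^ 2

/-- The polar form of `conicForm`, as a functional in its second argument. -/
def conicPolar (w : F3 × F3 × F3) : F3 × F3 × F3 →ₗ[F3] F3 where
  toFun v := w.1 * v.2.2 + w.2.2 * v.1 - 2 * w.2.1 * v.2.1
  map_add' u v := by simp; ring
  map_smul' c v := by simp; ring

theorem planeMap_injective (k : Option F3) : Function.Injective (planeMap k) := by
  rw [injective_iff_map_eq_zero]
  rintro ⟨x, y, z⟩ h
  have h0 := congrFun h 0
  have h1 := congrFun h 1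
  have h2 := congrFun h 2
  have h3 := congrFun h 3
  have h5 := congrFun h 5
  cases k <;> simp_all [planeMap, abk]

theorem planeMap_ne_zero (k : Option F3) {w : F3 × F3 × F3} (hw : w ≠ 0) :
    planeMap k w ≠ 0 := (map_ne_zero_iff _ (planeMap_injective k)).2 hw

theorem IsRep6.exists_smul_eq {v w : Fin 6 → F3} {Q : PG5} (hv : IsRep6 v Q)
    (hw : IsRep6 w Q) : ∃ c : F3, c ≠ 0 ∧ v = c • w := by
  obtain ⟨hv0, rfl⟩ := hv
  obtain ⟨hw0, h⟩ := hw
  obtain ⟨c, hc⟩ := (Projectivization.mk_eq_mk_iff F3 v w hv0 hw0).1 h.symm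
  exact ⟨c, c.ne_zero, hc.symm⟩

theorem IsRep6.smul {v : Fin 6 → F3} {Q : PG5} (hv : IsRep6 v Q) {c : F3} (hc : c ≠ 0) :
    IsRep6 (c • v) Q := by
  obtain ⟨hv0, rfl⟩ := hv
  exact ⟨smul_ne_zero hc hv0, (Projectivization.mk_eq_mk_iff' F3 _ _ _ _).2 ⟨c, rfl⟩⟩

theorem IsRep6.eq {v : Fin 6 → F3} {Q R : PG5} (hQ : IsRep6 v Q) (hR : IsRep6 v R) :
    Q = R := by
  obtain ⟨_, rfl⟩ := hQ
  obtain ⟨_, rfl⟩ := hR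
  rfl

theorem isRep6_mk {v : Fin 6 → F3} (hv : v ≠ 0) : IsRep6 v (Projectivization.mk F3 v hv) :=
  ⟨hv, rfl⟩

theorem isRep6_iff_mem {v : Fin 6 → F3} {Q : PG5} (hv : IsRep6 v Q)
    (L : Submodule F3 (Fin 6 → F3)) : (∃ w, IsRep6 w Q ∧ w ∈ L) ↔ v ∈ L := by
  refine ⟨?_, fun h => ⟨v, hv, h⟩⟩
  rintro ⟨w, hw, hwL⟩
  obtain ⟨c, -, rfl⟩ := hv.exists_smul_eq hw
  exact L.smul_mem c hwL

theorem mem_Δ_iff (k : Option F3) (j : F3) (Q : PG5) :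
    Q ∈ Δ k j ↔ ∃ w, w.2.2 ≠ 0 ∧ conicForm w = j ∧ IsRep6 (planeMap k w) Q := by
  have hmap (u : F3) : planeMap k (u ^ 2 + j, u, 1) = ![u ^ 2 + j, u * (abk k).1,
      u * (abk k).2, (abk k).1 ^ 2, (abk k).1 * (abk k).2, (abk k).2 ^ 2] := by
    simp [planeMap]
  constructor
  · rintro ⟨u, hu⟩
    exact ⟨(u ^ 2 + j, u, 1), one_ne_zero, by simp [conicForm], (hmap u).symm ▸ hu⟩
  · rintro ⟨⟨x, y, z⟩, hz, rfl, hQ⟩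
    have hnorm : ∀ x y z : F3, z ≠ 0 →
        z • (x, y, z) = ((z * y) ^ 2 + conicForm (x, y, z), z * y, 1) := by decide
    refine ⟨z * y, ?_⟩
    rw [← hmap, ← hnorm x y z hz, map_smul]
    exact hQ.smul hz

theorem mem_Δ_one_iff (k : Option F3) (Q : PG5) :
    Q ∈ Δ k 1 ↔ ∃ w, conicForm w = 1 ∧ IsRep6 (planeMap k w) Q := by
  rw [mem_Δ_iff]
  have hz : ∀ w, conicForm w = 1 → w.2.2 ≠ 0 := by decide
  exact exists_congr fun w => ⟨fun h => h.2, fun h => ⟨hz w h.1, h⟩⟩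

theorem mem_conicK_iff (k : Option F3) (Q : PG5) :
    Q ∈ conicK k ↔ ∃ w, conicForm w = 0 ∧ IsRep6 (planeMap k w) Q := by
  have hP : IsRep6 (planeMap k (1, 0, 0)) Ppt := by
    have h : planeMap k (1, 0, 0) = ![1, 0, 0, 0, 0, 0] := by simp [planeMap]
    rw [h]
    exact isRep6_mk _
  rw [conicK, Set.mem_union, mem_Δ_iff, Set.mem_singleton_iff]
  constructor
  · rintro (⟨w, -, h⟩ | rfl)
    · exact ⟨w, h⟩
    · exact ⟨(1, 0, 0), by simp [conicForm], hP⟩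
  · rintro ⟨w, hw, hQ⟩
    by_cases hz : w.2.2 = 0
    · right
      have hline : ∀ w, conicForm w = 0 → w.2.2 = 0 → w = w.1 • (1, 0, 0) := by decide
      have hw1 : w.1 ≠ 0 := by
        intro h
        apply hQ.choose
        rw [hline w hw hz, h, zero_smul, map_zero]
      rw [hline w hw hz, map_smul] at hQ
      exact hQ.eq (hP.smul hw1)
    · exact .inl ⟨w, hz, hw, hQ⟩

/-- The points of the conic `xz = y²`, parametrized by the projective line. -/
def conicParam : Option F3 → F3 × F3 × F3
  | some u => (u ^ 2, u, 1)
  | none => (1, 0, 0)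

theorem ncard_conicK (k : Option F3) : (conicK k).ncard = 4 := by
  have hne : ∀ o, conicParam o ≠ 0 := by decide
  have hform : ∀ o, conicForm (conicParam o) = 0 := by decide
  have hinj : ∀ o o' (c : F3), conicParam o = c • conicParam o' → o = o' := by decide
  have hsurj : ∀ w, w ≠ 0 → conicForm w = 0 → ∃ o, ∃ c : F3, c ≠ 0 ∧ w = c • conicParam o := by
    decide
  let f : Option F3 → PG5 := fun o =>
    Projectivization.mk F3 (planeMap k (conicParam o)) (planeMap_ne_zero k (hne o))
  have hf (o : Option F3) : IsRep6 (planeMap k (conicParam o)) (f o) := isRep6_mk _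
  have hrange : conicK k = Set.range f := by
    ext Q
    rw [mem_conicK_iff]
    constructor
    · rintro ⟨w, hw, hQ⟩
      have hw0 : w ≠ 0 := by
        rintro rfl
        exact hQ.choose (map_zero _)
      obtain ⟨o, c, hc, rfl⟩ := hsurj w hw0 hw
      rw [map_smul] at hQ
      exact ⟨o, ((hf o).smul hc).eq hQ⟩
    · rintro ⟨o, rfl⟩
      exact ⟨_, hform o, hf o⟩
  have hfinj : Function.Injective f := by
    intro o o' h
    obtain ⟨c, -, hc⟩ := (hf o).exists_smul_eq (h ▸ hf o')
    rw [← map_smul] at hc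
    exact hinj o o' c (planeMap_injective k hc)
  rw [hrange, ← Nat.card_coe_set_eq, Nat.card_range_of_injective hfinj]
  simp

theorem planeK_eq_range (k : Option F3) : planeK k = LinearMap.range (planeMap k) := by
  apply le_antisymm
  · refine Submodule.span_le.2 ?_
    rintro v ⟨Q, hQ, hv⟩
    obtain ⟨w, -, hw⟩ := (mem_conicK_iff k Q).1 hQ
    obtain ⟨c, -, rfl⟩ := hv.exists_smul_eq hw
    exact ⟨c • w, map_smul _ _ _⟩
  · rintro _ ⟨⟨x, y, z⟩, rfl⟩
    have hmem (w : F3 × F3 × F3) (hw0 : w ≠ 0) (hw : conicForm w = 0) :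
        planeMap k w ∈ planeK k :=
      Submodule.subset_span ⟨_, (mem_conicK_iff k _).2 ⟨w, hw, isRep6_mk _⟩,
        isRep6_mk (planeMap_ne_zero k hw0)⟩
    have hdecomp : (x, y, z) = (x - y) • (1, 0, 0) + y • (1, 1, 1) + (z - y) • (0, 0, 1) := by
      simp
    rw [hdecomp, map_add, map_add, map_smul, map_smul, map_smul]
    exact add_mem (add_mem (Submodule.smul_mem _ _ (hmem _ (by decide) (by decide)))
      (Submodule.smul_mem _ _ (hmem _ (by decide) (by decide))))
      (Submodule.smul_mem _ _ (hmem _ (by decide) (by decide)))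

theorem finrank_planeK (k : Option F3) : Module.finrank F3 (planeK k) = 3 := by
  rw [planeK_eq_range, LinearMap.finrank_range_of_inj (planeMap_injective k)]
  simp

/-- The tangent line to `m_k` at the point with plane coordinates `w`. -/
def tangentLine (k : Option F3) (w : F3 × F3 × F3) : Submodule F3 (Fin 6 → F3) :=
  (LinearMap.ker (conicPolar w)).map (planeMap k)

theorem planeMap_mem_tangentLine {k : Option F3} {w v : F3 × F3 × F3} :
    planeMap k v ∈ tangentLine k w ↔ conicPolar w v = 0 :=
  (planeMap_injective k).mem_set_image (s := LinearMap.ker (conicPolar w))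

theorem tangentLine_le (k : Option F3) (w : F3 × F3 × F3) : tangentLine k w ≤ planeK k := by
  rw [planeK_eq_range]
  exact LinearMap.map_le_range

theorem finrank_tangentLine (k : Option F3) {w : F3 × F3 × F3} (hw : w ≠ 0) :
    Module.finrank F3 (tangentLine k w) = 2 := by
  rw [tangentLine, ← (Submodule.equivMapOfInjective _ (planeMap_injective k) _).finrank_eq]
  have hex : ∀ w : F3 × F3 × F3, w ≠ 0 → ∃ v, conicPolar w v ≠ 0 := by decide
  have hpolar : conicPolar w ≠ 0 := by
    obtain ⟨v, hv⟩ := hex w hw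
    rintro h
    simp [h] at hv
  have h1 := Module.Dual.finrank_ker_add_one_of_ne_zero hpolar
  simp at h1
  omega

theorem ncard_tangentLine_inter_conicK (k : Option F3) {w : F3 × F3 × F3} (hw0 : w ≠ 0)
    (hw : conicForm w = 0) :
    ({R : PG5 | ∃ v, IsRep6 v R ∧ v ∈ tangentLine k w} ∩ conicK k).ncard = 1 := by
  have hself : ∀ w, conicForm w = 0 → conicPolar w w = 0 := by decide
  have huniq : ∀ w, w ≠ 0 ∧ conicForm w = 0 → ∀ v, conicForm v = 0 ∧ conicPolar w v = 0 →
      ∃ c : F3, v = c • w := by decide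
  have hP := isRep6_mk (planeMap_ne_zero k hw0)
  rw [Set.ncard_eq_one]
  refine ⟨_, Set.eq_singleton_iff_unique_mem.2 ⟨⟨⟨_, hP,
    planeMap_mem_tangentLine.2 (hself w hw)⟩, (mem_conicK_iff k _).2 ⟨w, hw, hP⟩⟩, ?_⟩⟩
  rintro R ⟨hR, hRc⟩
  obtain ⟨v, hv, hvR⟩ := (mem_conicK_iff k R).1 hRc
  obtain ⟨c, rfl⟩ := huniq w ⟨hw0, hw⟩ v
    ⟨hv, planeMap_mem_tangentLine.1 ((isRep6_iff_mem hvR _).1 hR)⟩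
  have hc : c ≠ 0 := by
    rintro rfl
    exact hvR.choose (by simp)
  rw [map_smul] at hvR
  exact hvR.eq (hP.smul hc)

/-- A line through a point where the conic form is `1` is never a tangent. -/
theorem ncard_inter_conicK_ne_one (k : Option F3) {v : F3 × F3 × F3} (hv : conicForm v = 1)
    {L : Submodule F3 (Fin 6 → F3)} (hvL : planeMap k v ∈ L) :
    ({R : PG5 | ∃ w, IsRep6 w R ∧ w ∈ L} ∩ conicK k).ncard ≠ 1 := by
  have hsecond : ∀ v, conicForm v = 1 → ∀ w, w ≠ 0 → conicForm w = 0 →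
      ∃ t : F3, conicForm (v + t • w) = 0 := by decide
  intro h
  obtain ⟨R, hR⟩ := Set.ncard_eq_one.1 h
  obtain ⟨hRL, hRc⟩ : R ∈ {R : PG5 | ∃ w, IsRep6 w R ∧ w ∈ L} ∩ conicK k := by rw [hR]; rfl
  obtain ⟨w, hw, hwR⟩ := (mem_conicK_iff k R).1 hRc
  have hwL := (isRep6_iff_mem hwR L).1 hRL
  have hw0 : w ≠ 0 := by
    rintro rfl
    exact hwR.choose (map_zero _)
  obtain ⟨t, ht⟩ := hsecond v hv w hw0 hw
  have hscale : ∀ (c : F3) (u : F3 × F3 × F3), conicForm (c • u) = c ^ 2 * conicForm u := by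
    intro c u
    simp [conicForm]
    ring
  have hnot : ∀ c : F3, v + t • w ≠ c • w := by
    intro c hc
    have hvw : v = (c - t) • w := by rw [sub_smul, ← hc, add_sub_cancel_right]
    rw [hvw, hscale, hw, mul_zero] at hv
    exact zero_ne_one hv
  have hrep := isRep6_mk (planeMap_ne_zero k (w := v + t • w) (by simpa using hnot 0))
  have hmem : planeMap k (v + t • w) ∈ L := by
    rw [map_add, map_smul]
    exact add_mem hvL (L.smul_mem t hwL)
  have hS := hR.subset ⟨⟨_, hrep, hmem⟩, (mem_conicK_iff k _).2 ⟨_, ht, hrep⟩⟩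
  rw [Set.mem_singleton_iff.1 hS] at hrep
  obtain ⟨c, -, hc⟩ := hrep.exists_smul_eq hwR
  rw [← map_smul] at hc
  exact hnot c (planeMap_injective k hc)

theorem Δ_one_eq_internal (k : Option F3) :
    Δ k 1 = {Q : PG5 | (∃ v, IsRep6 v Q ∧ v ∈ planeK k) ∧
        ∀ L : Submodule F3 (Fin 6 → F3), L ≤ planeK k → Module.finrank F3 L = 2 →
          ({R : PG5 | ∃ w, IsRep6 w R ∧ w ∈ L} ∩ conicK k).ncard = 1 →
          ¬∃ w, IsRep6 w Q ∧ w ∈ L} := by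
  ext Q
  rw [mem_Δ_one_iff]
  constructor
  · rintro ⟨v, hv, hQ⟩
    refine ⟨⟨_, hQ, planeK_eq_range k ▸ ⟨v, rfl⟩⟩, fun L _ _ hL hQL => ?_⟩
    exact ncard_inter_conicK_ne_one k hv ((isRep6_iff_mem hQ L).1 hQL) hL
  · rintro ⟨⟨v, hQ, hv⟩, h⟩
    rw [planeK_eq_range] at hv
    obtain ⟨v, rfl⟩ := hv
    refine ⟨v, ?_, hQ⟩
    by_contra hv
    have htangent : ∀ v, conicForm v ≠ 1 →
        ∃ w, w ≠ 0 ∧ conicForm w = 0 ∧ conicPolar w v = 0 := by decide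
    obtain ⟨w, hw0, hw, hwv⟩ := htangent v hv
    exact h _ (tangentLine_le k w) (finrank_tangentLine k hw0)
      (ncard_tangentLine_inter_conicK k hw0 hw) ⟨_, hQ, planeMap_mem_tangentLine.2 hwv⟩

theorem Kset_eq_iUnion : Kset = ⋃ k : Option F3, Δ k 1 := by
  ext Q
  rw [Set.mem_iUnion]
  constructor
  · rintro ⟨x₀, x₁, x₂, hx, hQ⟩
    have hdir : ∀ x₁ x₂ : F3, (x₁, x₂) ≠ (0, 0) →
        ∃ k, ∃ s : F3, s ^ 2 = 1 ∧ x₁ = s * (abk k).1 ∧ x₂ = s * (abk k).2 := by decide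
    obtain ⟨k, s, hs, rfl, rfl⟩ := hdir x₁ x₂ hx
    refine ⟨k, s * x₀, ?_⟩
    convert hQ using 2
    · linear_combination x₀ ^ 2 * hs
    congr 1
    · ring
    congr 1
    · ring
    congr 1
    · linear_combination -(abk k).1 ^ 2 * hs
    congr 1
    · linear_combination -(abk k).1 * (abk k).2 * hs
    congr 1
    linear_combination -(abk k).2 ^ 2 * hs
  · rintro ⟨k, u, hQ⟩
    have hne : ∀ k, ((abk k).1, (abk k).2) ≠ (0, 0) := by decide
    exact ⟨u, _, _, hne k, hQ⟩

/-- For each `k ∈ F ∪ {∞}`, the conic `m_k := Δ_{k,0} ∪ {P}` consists of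
4 points whose representative vectors span a 3-dimensional subspace `π_k` of `F⁶`, and
`Δ_{k,1}` equals the set of internal points of `m_k`, i.e. the points `[v]` with
`v ∈ π_k` lying on no line of the plane `π_k` meeting `m_k` in exactly one point.
Consequently `K = ⋃ₖ Δ_{k,1}` is exactly the union of the internal points of the four
conics of the Veronese surface through `P`. -/
theorem Kset_eq_union_of_internal_points :
    (∀ k : Option F3,
      (conicK k).ncard = 4 ∧
      Module.finrank F3 (planeK k) = 3 ∧
      Δ k 1 = {Q : PG5 | (∃ v, IsRep6 v Q ∧ v ∈ planeK k) ∧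
        ∀ L : Submodule F3 (Fin 6 → F3), L ≤ planeK k → Module.finrank F3 L = 2 →
          ({R : PG5 | ∃ w, IsRep6 w R ∧ w ∈ L} ∩ conicK k).ncard = 1 →
          ¬∃ w, IsRep6 w Q ∧ w ∈ L}) ∧
    Kset = ⋃ k : Option F3, Δ k 1 := by
  exact ⟨fun k => ⟨ncard_conicK k, finrank_planeK k, Δ_one_eq_internal k⟩, Kset_eq_iUnion⟩
end

section
/- The assignment [(x₀, x₁, x₂)] ↦ [(x₀²+1, x₀x₁, x₀x₂, x₁², x₁x₂, x₂²)] is a well-defined map ψ from W := PG(2,3) \ {U} to PG(5,3) (independent of the chosen representative, since λ² = 1 for every nonzero λ ∈ F), and ψ is a bijection from W onto K. -/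
/-- `PG(2,3)`: the projective space of `F³`. -/
abbrev PG2 := Projectivization F3 (Fin 3 → F3)

/-- `v` is a representative vector of the projective point `X ∈ PG(2,3)`. -/
def IsRep3 (v : Fin 3 → F3) (X : PG2) : Prop :=
  ∃ hv : v ≠ 0, Projectivization.mk F3 v hv = X

/-- The point `U = [(1,0,0)] ∈ PG(2,3)`. -/
def Upt : PG2 := Projectivization.mk F3 ![1, 0, 0] (by decide)

/-- The vector of quadratic forms `(x₀² + 1, x₀x₁, x₀x₂, x₁², x₁x₂, x₂²)`. -/
def quadVec (v : Fin 3 → F3) : Fin 6 → F3 :=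
  ![v 0 ^ 2 + 1, v 0 * v 1, v 0 * v 2, v 1 ^ 2, v 1 * v 2, v 2 ^ 2]

theorem F3.sq_eq_one {a : F3} (ha : a ≠ 0) : a ^ 2 = 1 := by
  revert a; decide

theorem quadVec_ne_zero (v : Fin 3 → F3) : quadVec v ≠ 0 := by
  have key : ∀ x : F3, x ^ 2 + 1 ≠ 0 := by decide
  exact fun h => key (v 0) (congrFun h 0)

theorem quadVec_smul {a : F3} (ha : a ≠ 0) (v : Fin 3 → F3) : quadVec (a • v) = quadVec v := by
  have h := F3.sq_eq_one ha
  funext i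
  fin_cases i <;> simp [quadVec] <;> grind

theorem mk_eq_Upt_iff {v : Fin 3 → F3} (hv : v ≠ 0) :
    Projectivization.mk F3 v hv = Upt ↔ v 1 = 0 ∧ v 2 = 0 := by
  rw [Upt, Projectivization.mk_eq_mk_iff']
  constructor
  · rintro ⟨a, rfl⟩
    simp
  · rintro ⟨h1, h2⟩
    refine ⟨v 0, ?_⟩
    funext i
    fin_cases i <;> simp [h1, h2]

/-- Two nonzero pairs over `GF(3)` whose binary quadratic Veronese images are proportional
are themselves proportional, and their images are equal. -/
theorem F3.proportional_of_veronese : ∀ a x₁ x₂ y₁ y₂ : F3, ¬ (x₁ = 0 ∧ x₂ = 0) →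
    a * y₁ ^ 2 = x₁ ^ 2 → a * (y₁ * y₂) = x₁ * x₂ → a * y₂ ^ 2 = x₂ ^ 2 →
    a = 1 ∧ ∃ b : F3, b ≠ 0 ∧ b * y₁ = x₁ ∧ b * y₂ = x₂ := by
  decide

theorem eq_smul_of_quadVec_eq_smul {v w : Fin 3 → F3} {a : F3} (hv : ¬ (v 1 = 0 ∧ v 2 = 0))
    (h : a • quadVec w = quadVec v) : ∃ b : F3, b • w = v := by
  have e (i : Fin 6) := congrFun h i
  have e1 : a * (w 0 * w 1) = v 0 * v 1 := e 1
  have e2 : a * (w 0 * w 2) = v 0 * v 2 := e 2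
  obtain ⟨rfl, b, hb, h1, h2⟩ :=
    F3.proportional_of_veronese a (v 1) (v 2) (w 1) (w 2) hv (e 3) (e 4) (e 5)
  have hb2 := F3.sq_eq_one hb
  have h0 : b * w 0 = v 0 := by
    by_cases hv1 : v 1 = 0
    · have hv2 : v 2 ≠ 0 := fun h => hv ⟨hv1, h⟩
      apply mul_right_cancel₀ hv2
      linear_combination e2 - b * w 0 * h2 + w 0 * w 2 * hb2
    · apply mul_right_cancel₀ hv1
      linear_combination e1 - b * w 0 * h1 + w 0 * w 1 * hb2
  refine ⟨b, ?_⟩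
  funext i
  fin_cases i
  exacts [h0, h1, h2]

/-- The map `PG(2,3) → PG(5,3)` induced by `quadVec`. -/
def quadMap : PG2 → PG5 :=
  Projectivization.lift (fun v => Projectivization.mk F3 (quadVec v) (quadVec_ne_zero v)) <| by
    rintro ⟨v, hv⟩ ⟨w, hw⟩ a (rfl : v = a • w)
    have ha : a ≠ 0 := by
      rintro rfl
      simp at hv
    simp only [quadVec_smul ha]

theorem quadMap_mk {v : Fin 3 → F3} (hv : v ≠ 0) :
    quadMap (Projectivization.mk F3 v hv) =
      Projectivization.mk F3 (quadVec v) (quadVec_ne_zero v) := rfl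

/-- The assignment `[(x₀,x₁,x₂)] ↦ [(x₀²+1, x₀x₁, x₀x₂, x₁², x₁x₂, x₂²)]`
is a well-defined map `ψ` from `W := PG(2,3) \ {U}` to `PG(5,3)` (independent of the
representative), and `ψ` is a bijection from `W` onto `K`. -/
theorem psi_well_defined_bijection :
    ∃ ψ : PG2 → PG5,
      (∀ (x₀ x₁ x₂ : F3) (h : ![x₀, x₁, x₂] ≠ 0),
        Projectivization.mk F3 ![x₀, x₁, x₂] h ≠ Upt →
        IsRep6 ![x₀ ^ 2 + 1, x₀ * x₁, x₀ * x₂, x₁ ^ 2, x₁ * x₂, x₂ ^ 2]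
          (ψ (Projectivization.mk F3 ![x₀, x₁, x₂] h))) ∧
      Set.BijOn ψ {Upt}ᶜ Kset := by
  refine ⟨quadMap, fun x₀ x₁ x₂ h _ => ⟨quadVec_ne_zero ![x₀, x₁, x₂], rfl⟩, ?_, ?_, ?_⟩
  · intro X hX
    induction X using Projectivization.ind with
    | h v hv =>
      rw [Set.mem_compl_singleton_iff, Ne, mk_eq_Upt_iff] at hX
      exact ⟨v 0, v 1, v 2, by simpa using hX, quadVec_ne_zero v, rfl⟩
  · intro X hX Y _ hXY
    induction X using Projectivization.ind with
    | h v hv =>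
      induction Y using Projectivization.ind with
      | h w hw =>
        rw [Set.mem_compl_singleton_iff, Ne, mk_eq_Upt_iff] at hX
        rw [quadMap_mk, quadMap_mk, Projectivization.mk_eq_mk_iff'] at hXY
        obtain ⟨a, ha⟩ := hXY
        exact (Projectivization.mk_eq_mk_iff' ..).2 (eq_smul_of_quadVec_eq_smul hX ha)
  · rintro _ ⟨x₀, x₁, x₂, hx, _, rfl⟩
    have hx' : ¬ (x₁ = 0 ∧ x₂ = 0) := by simpa using hx
    have hv : ![x₀, x₁, x₂] ≠ 0 := fun h => hx' ⟨congrFun h 1, congrFun h 2⟩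
    exact ⟨Projectivization.mk F3 _ hv, mt (mk_eq_Upt_iff hv).1 hx', rfl⟩
end

section
/- Every conic C in PG(2,3) has exactly 4 points and exactly 3 internal points; moreover, a point Q of PG(2,3) is an internal point of C if and only if C can be partitioned into two pairs {A, B} and {C', D} such that Q lies on the line through A and B and on the line through C' and D (i.e. the internal points of C are precisely the three diagonal points of the quadrangle C). -/
/-- A line of `PG(2,3)`: the set of projective points of a 2-dimensional subspace of `F³`. -/
def IsLine2 (L : Set PG2) : Prop :=
  ∃ W : Submodule F3 (Fin 3 → F3), Module.finrank F3 W = 2 ∧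
    L = {X | ∃ v, IsRep3 v X ∧ v ∈ W}

/-- A conic in `PG(2,3)`: the set of projective zeros of a quadratic form `q` on `F³`
whose polar bilinear form `B(x,y) = q(x+y) − q(x) − q(y)` is nondegenerate. -/
def IsConic2 (C : Set PG2) : Prop :=
  ∃ q : QuadraticForm F3 (Fin 3 → F3),
    (∀ x : Fin 3 → F3, (∀ y, q (x + y) - q x - q y = 0) → x = 0) ∧
    C = {X | ∀ v, IsRep3 v X → q v = 0}

/-- A line is a tangent of a conic `C` if it meets `C` in exactly one point. -/
def IsTangent2 (L C : Set PG2) : Prop :=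
  IsLine2 L ∧ (L ∩ C).ncard = 1

/-- A point of `PG(2,3)` is an internal point of `C` if it lies on no tangent of `C`. -/
def IsInternal2 (X : PG2) (C : Set PG2) : Prop :=
  ∀ L : Set PG2, IsTangent2 L C → X ∉ L

/-- Normalized representatives of the 13 points (and, dually, of the 13 lines) of `PG(2,3)`. -/
def pgVec : Fin 13 → Fin 3 → F3 :=
  ![![1, 0, 0], ![0, 1, 0], ![0, 0, 1], ![1, 1, 0], ![1, 2, 0], ![1, 0, 1], ![1, 0, 2],
    ![0, 1, 1], ![0, 1, 2], ![1, 1, 1], ![1, 1, 2], ![1, 2, 1], ![1, 2, 2]]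

/-- Indices of the points on the line with coordinate vector `pgVec j`. -/
def pgLine (j : Fin 13) : Finset (Fin 13) := {i | pgVec j ⬝ᵥ pgVec i = 0}

/-- Indices of the projective zeros of the diagonal form with weights `w`. -/
def pgConic (w : Fin 3 → F3) : Finset (Fin 13) :=
  {i | ∑ k, w k * (pgVec i k * pgVec i k) = 0}

/-- Indices of the points on no tangent of `pgConic w`. -/
def pgInternal (w : Fin 3 → F3) : Finset (Fin 13) :=
  {i | ∀ j, (pgLine j ∩ pgConic w).card = 1 → i ∉ pgLine j}

/-- Some line contains the points with indices `a`, `b` and `i`. -/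
def pgCollinear (a b i : Fin 13) : Prop := ∃ j, a ∈ pgLine j ∧ b ∈ pgLine j ∧ i ∈ pgLine j

instance (a b i : Fin 13) : Decidable (pgCollinear a b i) := by
  unfold pgCollinear; infer_instance

set_option maxRecDepth 100000

theorem exists_smul_pgVec_eq :
    ∀ v : Fin 3 → F3, v ≠ 0 → ∃ i, ∃ a : F3, a ≠ 0 ∧ a • pgVec i = v := by decide

theorem eq_of_smul_pgVec_eq : ∀ i j, ∀ a : F3, a • pgVec j = pgVec i → i = j := by decide

theorem pgVec_ne_zero : ∀ i, pgVec i ≠ 0 := by decide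

theorem card_pgConic : ∀ w : Fin 3 → F3, (∀ k, w k ≠ 0) → (pgConic w).card = 4 := by
  decide +kernel

theorem card_pgInternal : ∀ w : Fin 3 → F3, (∀ k, w k ≠ 0) → (pgInternal w).card = 3 := by
  decide +kernel

theorem mem_pgInternal_iff : ∀ w : Fin 3 → F3, (∀ k, w k ≠ 0) → ∀ i,
    i ∈ pgInternal w ↔
      ∃ a ∈ pgConic w, ∃ b ∈ pgConic w, ∃ c ∈ pgConic w, ∃ d ∈ pgConic w,
        (a ≠ b ∧ a ≠ c ∧ a ≠ d ∧ b ≠ c ∧ b ≠ d ∧ c ≠ d) ∧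
          pgConic w = {a, b, c, d} ∧ pgCollinear a b i ∧ pgCollinear c d i := by
  decide +kernel

open Projectivization in
/-- The coordinates of the points of `PG(2,3)` with respect to the basis given by `e`. -/
noncomputable def pgPoint (e : (Fin 3 → F3) ≃ₗ[F3] (Fin 3 → F3)) (i : Fin 13) : PG2 :=
  mk F3 (e (pgVec i)) (e.map_ne_zero_iff.2 (pgVec_ne_zero i))

section

variable (e : (Fin 3 → F3) ≃ₗ[F3] (Fin 3 → F3))

theorem isRep3_pgPoint_iff (v : Fin 3 → F3) (i : Fin 13) :
    IsRep3 v (pgPoint e i) ↔ ∃ a : F3, a ≠ 0 ∧ v = a • e (pgVec i) := by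
  constructor
  · rintro ⟨hv, h⟩
    obtain ⟨a, rfl⟩ := (Projectivization.mk_eq_mk_iff _ _ _ _ _).1 h
    exact ⟨a, a.ne_zero, rfl⟩
  · rintro ⟨a, ha, rfl⟩
    exact ⟨smul_ne_zero ha (e.map_ne_zero_iff.2 (pgVec_ne_zero i)),
      (Projectivization.mk_eq_mk_iff _ _ _ _ _).2 ⟨Units.mk0 a ha, rfl⟩⟩

theorem bijective_pgPoint : Function.Bijective (pgPoint e) := by
  constructor
  · intro i j h
    obtain ⟨a, ha⟩ := (Projectivization.mk_eq_mk_iff _ _ _ _ _).1 h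
    refine eq_of_smul_pgVec_eq i j a (e.injective ?_)
    rw [map_smul]
    exact ha
  · intro X
    induction X using Projectivization.ind with
    | h v hv =>
      obtain ⟨i, a, ha, h⟩ := exists_smul_pgVec_eq (e.symm v) (e.symm.map_ne_zero_iff.2 hv)
      obtain ⟨_, h'⟩ := (isRep3_pgPoint_iff e v i).2
        ⟨a, ha, by rw [← map_smul, h, e.apply_symm_apply]⟩
      exact ⟨i, h'.symm⟩

theorem isLine2_iff_exists_dual (L : Set PG2) :
    IsLine2 L ↔ ∃ f : Module.Dual F3 (Fin 3 → F3), f ≠ 0 ∧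
      L = {X | ∃ v, IsRep3 v X ∧ f v = 0} := by
  constructor
  · rintro ⟨W, hW, rfl⟩
    obtain ⟨f, hf, hle⟩ := Submodule.exists_le_ker_of_lt_top W (lt_top_iff_ne_top.2 (by
      rintro rfl
      simp at hW))
    have hk := Module.Dual.finrank_ker_add_one_of_ne_zero hf
    rw [Module.finrank_fin_fun] at hk
    obtain rfl := Submodule.eq_of_le_of_finrank_eq hle (by omega)
    exact ⟨f, hf, rfl⟩
  · rintro ⟨f, hf, rfl⟩
    have hk := Module.Dual.finrank_ker_add_one_of_ne_zero hf
    rw [Module.finrank_fin_fun] at hk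
    exact ⟨LinearMap.ker f, by omega, rfl⟩

theorem pgPoint_mem_dual_iff (f : Module.Dual F3 (Fin 3 → F3)) (i : Fin 13) :
    (∃ v, IsRep3 v (pgPoint e i) ∧ f v = 0) ↔ f (e (pgVec i)) = 0 := by
  simp only [isRep3_pgPoint_iff]
  constructor
  · rintro ⟨_, ⟨a, ha, rfl⟩, h⟩
    simpa [ha] using h
  · intro h
    exact ⟨_, ⟨1, one_ne_zero, (one_smul _ _).symm⟩, h⟩

theorem isLine2_iff (L : Set PG2) :
    IsLine2 L ↔ ∃ j, L = pgPoint e '' pgLine j := by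
  have key (f : Module.Dual F3 (Fin 3 → F3)) (j : Fin 13) (a : F3) (ha : a ≠ 0)
      (h : ∀ x, f (e x) = a * (pgVec j ⬝ᵥ x)) :
      {X | ∃ v, IsRep3 v X ∧ f v = 0} = pgPoint e '' pgLine j := by
    ext X
    obtain ⟨i, rfl⟩ := (bijective_pgPoint e).2 X
    rw [(bijective_pgPoint e).1.mem_set_image, Set.mem_ofPred_eq, pgPoint_mem_dual_iff, h]
    simp [pgLine, ha]
  rw [isLine2_iff_exists_dual]
  constructor
  · rintro ⟨f, hf, rfl⟩
    obtain ⟨u, hu⟩ := (dotProductEquiv F3 (Fin 3)).surjective (f ∘ₗ e.toLinearMap)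
    have hu' (x) : f (e x) = u ⬝ᵥ x := (LinearMap.congr_fun hu x).symm
    have hu0 : u ≠ 0 := by
      rintro rfl
      refine hf (LinearMap.ext fun x => ?_)
      simpa using hu' (e.symm x)
    obtain ⟨j, a, ha, rfl⟩ := exists_smul_pgVec_eq u hu0
    exact ⟨j, key f j a ha fun x => by rw [hu', smul_dotProduct, smul_eq_mul]⟩
  · rintro ⟨j, rfl⟩
    have h (x) : (dotProductEquiv F3 (Fin 3) (pgVec j) ∘ₗ e.symm.toLinearMap) (e x) =
        1 * (pgVec j ⬝ᵥ x) := by simp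
    refine ⟨_, fun h0 => pgVec_ne_zero j ?_, (key _ j 1 one_ne_zero h).symm⟩
    rw [← (dotProductEquiv F3 (Fin 3)).map_eq_zero_iff]
    ext x
    simpa using LinearMap.congr_fun h0 (e (Pi.single x 1))

theorem setOf_forall_isRep3_eq (q : QuadraticForm F3 (Fin 3 → F3)) (w : Fin 3 → F3)
    (h : ∀ x, q (e x) = ∑ k, w k * (x k * x k)) :
    {X | ∀ v, IsRep3 v X → q v = 0} = pgPoint e '' pgConic w := by
  ext X
  obtain ⟨i, rfl⟩ := (bijective_pgPoint e).2 X
  rw [(bijective_pgPoint e).1.mem_set_image]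
  simp only [Set.mem_ofPred_eq, isRep3_pgPoint_iff, pgConic, Finset.coe_filter, Finset.mem_univ,
    true_and, ← h]
  constructor
  · intro hq
    exact hq _ ⟨1, one_ne_zero, (one_smul _ _).symm⟩
  · rintro hq _ ⟨a, -, rfl⟩
    rw [QuadraticMap.map_smul, hq, smul_zero]

theorem isInternal2_pgPoint_iff (w : Fin 3 → F3) (i : Fin 13) :
    IsInternal2 (pgPoint e i) (pgPoint e '' pgConic w) ↔ i ∈ pgInternal w := by
  have hinj := (bijective_pgPoint e).1
  have hc (j : Fin 13) : (pgPoint e '' pgLine j ∩ pgPoint e '' pgConic w).ncard =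
      (pgLine j ∩ pgConic w).card := by
    rw [← Set.image_inter hinj, Set.ncard_image_of_injective _ hinj, ← Finset.coe_inter,
      Set.ncard_coe_finset]
  simp only [IsInternal2, IsTangent2, isLine2_iff e, pgInternal, Finset.mem_filter,
    Finset.mem_univ, true_and]
  constructor
  · intro h j hj hi
    exact h _ ⟨⟨j, rfl⟩, (hc j).trans hj⟩ (Set.mem_image_of_mem _ hi)
  · rintro h _ ⟨⟨j, rfl⟩, hj⟩ hi
    exact h j ((hc j).symm.trans hj) (hinj.mem_set_image.1 hi)

theorem exists_isLine2_pgPoint_iff (a b i : Fin 13) :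
    (∃ L, IsLine2 L ∧ pgPoint e a ∈ L ∧ pgPoint e b ∈ L ∧ pgPoint e i ∈ L) ↔
      pgCollinear a b i := by
  have hinj := (bijective_pgPoint e).1
  simp only [isLine2_iff e, pgCollinear]
  constructor
  · rintro ⟨_, ⟨j, rfl⟩, ha, hb, hi⟩
    exact ⟨j, hinj.mem_set_image.1 ha, hinj.mem_set_image.1 hb, hinj.mem_set_image.1 hi⟩
  · rintro ⟨j, ha, hb, hi⟩
    exact ⟨_, ⟨j, rfl⟩, Set.mem_image_of_mem _ ha, Set.mem_image_of_mem _ hb,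
      Set.mem_image_of_mem _ hi⟩

end

/-- A quadratic form on `F³` with nondegenerate polar form is diagonal with nonzero weights in a
suitable basis. -/
theorem exists_diagonalization (q : QuadraticForm F3 (Fin 3 → F3))
    (hq : ∀ x : Fin 3 → F3, (∀ y, q (x + y) - q x - q y = 0) → x = 0) :
    ∃ (e : (Fin 3 → F3) ≃ₗ[F3] (Fin 3 → F3)) (w : Fin 3 → F3), (∀ k, w k ≠ 0) ∧
      ∀ x, q (e x) = ∑ k, w k * (x k * x k) := by
  have two_ne_zero : (2 : F3) ≠ 0 := by decide
  let : Invertible (2 : F3) := invertibleOfNonzero two_ne_zero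
  have hsep : (QuadraticMap.associated (R := F3) q).SeparatingLeft := by
    intro x hx
    refine hq x fun y => ?_
    have h := hx y
    rw [QuadraticMap.associated_apply] at h
    rw [← smul_invOf_smul (2 : Module.End F3 F3) (q (x + y) - q x - q y), h, smul_zero]
  obtain ⟨w, ⟨g⟩⟩ := QuadraticForm.equivalent_weightedSumSquares_units_of_nondegenerate' q hsep
  revert w
  rw [Module.finrank_fin_fun]
  intro w g
  refine ⟨g.symm.toLinearEquiv, fun k => w k, fun k => (w k).ne_zero, fun x => ?_⟩
  refine (g.symm.map_app x).trans ?_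
  simp [QuadraticMap.weightedSumSquares_apply, Units.smul_def]

/-- Every conic `C` in `PG(2,3)` has exactly 4 points and exactly 3
internal points; moreover a point `Q` is internal iff `C` can be partitioned into two
pairs `{A,B}` and `{C',D}` such that `Q` lies on the line through `A` and `B` and on
the line through `C'` and `D` (the internal points are the diagonal points of the
quadrangle `C`). -/
theorem conic_internal_points_are_diagonal_points :
    ∀ C : Set PG2, IsConic2 C →
      C.ncard = 4 ∧
      {Q : PG2 | IsInternal2 Q C}.ncard = 3 ∧
      (∀ Q : PG2, IsInternal2 Q C ↔
        ∃ A B C' D : PG2, A ≠ B ∧ A ≠ C' ∧ A ≠ D ∧ B ≠ C' ∧ B ≠ D ∧ C' ≠ D ∧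
          C = {A, B, C', D} ∧
          (∃ L, IsLine2 L ∧ A ∈ L ∧ B ∈ L ∧ Q ∈ L) ∧
          (∃ L, IsLine2 L ∧ C' ∈ L ∧ D ∈ L ∧ Q ∈ L)) := by
  rintro _ ⟨q, hq, rfl⟩
  obtain ⟨e, w, hw, h⟩ := exists_diagonalization q hq
  rw [setOf_forall_isRep3_eq e q w h]
  have hinj := (bijective_pgPoint e).1
  have hsurj := (bijective_pgPoint e).2
  refine ⟨?_, ?_, fun Q => ?_⟩
  · rw [Set.ncard_image_of_injective _ hinj, Set.ncard_coe_finset, card_pgConic w hw]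
  · have hI : {Q | IsInternal2 Q (pgPoint e '' pgConic w)} = pgPoint e '' pgInternal w := by
      ext Q
      obtain ⟨i, rfl⟩ := hsurj Q
      rw [hinj.mem_set_image, Set.mem_ofPred_eq, isInternal2_pgPoint_iff, Finset.mem_coe]
    rw [hI, Set.ncard_image_of_injective _ hinj, Set.ncard_coe_finset, card_pgInternal w hw]
  · obtain ⟨i, rfl⟩ := hsurj Q
    have hset (a b c d : Fin 13) : pgPoint e '' pgConic w =
        {pgPoint e a, pgPoint e b, pgPoint e c, pgPoint e d} ↔ pgConic w = {a, b, c, d} := by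
      rw [← Finset.coe_inj, ← hinj.image_injective.eq_iff]
      simp [Set.image_insert_eq]
    rw [isInternal2_pgPoint_iff, mem_pgInternal_iff w hw]
    simp only [hsurj.exists, hinj.ne_iff, hset, exists_isLine2_pgPoint_iff]
    constructor
    · rintro ⟨a, -, b, -, c, -, d, -, ⟨h1, h2, h3, h4, h5, h6⟩, h7⟩
      exact ⟨a, b, c, d, h1, h2, h3, h4, h5, h6, h7⟩
    · rintro ⟨a, b, c, d, h1, h2, h3, h4, h5, h6, hS, h7⟩
      exact ⟨a, by simp [hS], b, by simp [hS], c, by simp [hS], d, by simp [hS],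
        ⟨h1, h2, h3, h4, h5, h6⟩, hS, h7⟩
end

section
/- Let C be a conic in PG(2,3) and let P, Y ∈ C with Y ≠ P. Then the line through P and Y contains exactly one internal point of C. -/
lemma isRep3_smul_iff {v : Fin 3 → F3} (hv : v ≠ 0) {w : Fin 3 → F3} :
    IsRep3 w (Projectivization.mk F3 v hv) ↔ ∃ a : F3, a ≠ 0 ∧ w = a • v := by
  constructor
  · rintro ⟨hw, h⟩
    obtain ⟨a, ha⟩ := (Projectivization.mk_eq_mk_iff F3 w v hw hv).1 h
    exact ⟨a, a.ne_zero, ha.symm⟩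
  · rintro ⟨a, ha, rfl⟩
    exact ⟨smul_ne_zero ha hv,
      (Projectivization.mk_eq_mk_iff' F3 _ _ _ _).2 ⟨a, rfl⟩⟩

lemma mk_mem_conic_iff (q : QuadraticForm F3 (Fin 3 → F3)) {v : Fin 3 → F3} (hv : v ≠ 0) :
    Projectivization.mk F3 v hv ∈ {X : PG2 | ∀ v, IsRep3 v X → q v = 0} ↔ q v = 0 := by
  constructor
  · intro h
    exact h v ⟨hv, rfl⟩
  · intro h w hw
    obtain ⟨a, -, rfl⟩ := (isRep3_smul_iff hv).1 hw
    simp [QuadraticMap.map_smul, h]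

lemma mk_mem_line_iff (W : Submodule F3 (Fin 3 → F3)) {v : Fin 3 → F3} (hv : v ≠ 0) :
    Projectivization.mk F3 v hv ∈ {X : PG2 | ∃ v, IsRep3 v X ∧ v ∈ W} ↔ v ∈ W := by
  constructor
  · rintro ⟨w, hw, hwW⟩
    obtain ⟨a, ha, rfl⟩ := (isRep3_smul_iff hv).1 hw
    exact (W.smul_mem_iff ha).1 hwW
  · intro h
    exact ⟨v, ⟨hv, rfl⟩, h⟩

lemma map_smul_add_smul (q : QuadraticForm F3 (Fin 3 → F3)) (u t : Fin 3 → F3) (a b : F3) :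
    q (a • u + b • t) = a * a * q u + b * b * q t + a * b * QuadraticMap.polar q u t := by
  rw [QuadraticMap.map_add q, QuadraticMap.map_smul, QuadraticMap.map_smul,
    QuadraticMap.polar_smul_left, QuadraticMap.polar_smul_right]
  simp only [smul_eq_mul]
  ring

/-- If `t` is singular, `u` is not, and `u` is orthogonal to `t`, then the line joining them is
tangent to the conic of `q`, at `t`. -/
lemma isTangent2_span_pair (q : QuadraticForm F3 (Fin 3 → F3)) {u t : Fin 3 → F3}
    (ht : t ≠ 0) (hqt : q t = 0) (hqu : q u ≠ 0) (hut : QuadraticMap.polar q u t = 0) :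
    IsTangent2 {X | ∃ v, IsRep3 v X ∧ v ∈ Submodule.span F3 {u, t}}
      {X | ∀ v, IsRep3 v X → q v = 0} := by
  have hq (a b : F3) : q (a • u + b • t) = a * a * q u := by
    rw [map_smul_add_smul, hqt, hut]
    ring
  refine ⟨⟨_, ?_, rfl⟩, Set.ncard_eq_one.2 ⟨Projectivization.mk F3 t ht, ?_⟩⟩
  · have hli : LinearIndependent F3 ![u, t] := by
      refine LinearIndependent.pair_iff.2 fun a b h ↦ ?_
      have ha : a = 0 := by
        have := hq a b
        rw [h, QuadraticMap.map_zero] at this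
        simpa [hqu] using this.symm
      subst ha
      simpa [ht] using h
    have := finrank_span_eq_card hli
    rwa [Matrix.range_cons_cons_empty, Fintype.card_fin] at this
  · ext X
    induction X using Projectivization.ind with
    | h v hv =>
      rw [Set.mem_inter_iff, mk_mem_conic_iff, mk_mem_line_iff, Set.mem_singleton_iff]
      constructor
      · rintro ⟨hvW, hqv⟩
        obtain ⟨a, b, rfl⟩ := Submodule.mem_span_pair.1 hvW
        have ha : a = 0 := by simpa [hq, hqu] using hqv
        subst ha
        exact (Projectivization.mk_eq_mk_iff' F3 _ _ _ _).2 ⟨b, by simp⟩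
      · intro h
        obtain ⟨a, rfl⟩ := (Projectivization.mk_eq_mk_iff' F3 _ _ _ _).1 h
        exact ⟨Submodule.smul_mem _ _ (Submodule.subset_span (by simp)),
          by simp [QuadraticMap.map_smul, hqt]⟩

/-- A nonsingular vector whose orthogonal complement is anisotropic represents an internal
point. -/
lemma isInternal2_mk (q : QuadraticForm F3 (Fin 3 → F3)) {u : Fin 3 → F3} (hu : u ≠ 0)
    (hqu : q u ≠ 0) (hperp : ∀ t, q t = 0 → QuadraticMap.polar q u t = 0 → t = 0) :
    IsInternal2 (Projectivization.mk F3 u hu) {X | ∀ v, IsRep3 v X → q v = 0} := by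
  rintro L ⟨⟨W, -, rfl⟩, hcard⟩ huL
  rw [mk_mem_line_iff] at huL
  obtain ⟨T, hT⟩ := Set.ncard_eq_one.1 hcard
  induction T using Projectivization.ind with
  | h t ht =>
    have hmem := hT.ge (Set.mem_singleton _)
    rw [Set.mem_inter_iff, mk_mem_conic_iff, mk_mem_line_iff] at hmem
    obtain ⟨htW, hqt⟩ := hmem
    set m := QuadraticMap.polar q u t with hm
    have hm0 : m ≠ 0 := fun h ↦ ht (hperp t hqt h)
    -- the reflection of `t` in the hyperplane orthogonal to `u`
    set s := (-(m / q u)) • u + (1 : F3) • t with hs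
    have hqs : q s = 0 := by
      rw [hs, map_smul_add_smul, ← hm, hqt]
      field_simp
      ring
    have key (b : F3) : b • t ≠ s := by
      intro h
      have hc : (m / q u) • u = (1 - b) • t := by
        rw [sub_smul, h, hs]
        module
      have := congrArg q hc
      rw [QuadraticMap.map_smul, QuadraticMap.map_smul, hqt, smul_zero, smul_eq_mul] at this
      simp [hm0, hqu] at this
    have hs0 : s ≠ 0 := fun h ↦ key 0 (by simp [h])
    have hsT : Projectivization.mk F3 s hs0 ∈ ({Projectivization.mk F3 t ht} : Set PG2) := by
      rw [← hT, Set.mem_inter_iff, mk_mem_conic_iff, mk_mem_line_iff]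
      exact ⟨W.add_mem (W.smul_mem _ huL) (W.smul_mem _ htW), hqs⟩
    obtain ⟨b, hb⟩ := (Projectivization.mk_eq_mk_iff' F3 _ _ _ _).1 hsT
    exact key b hb

lemma linearIndependent_triple_iff {p y z : Fin 3 → F3} :
    LinearIndependent F3 ![p, y, z] ↔
      ∀ a b c : F3, a • p + b • y + c • z = 0 → a = 0 ∧ b = 0 ∧ c = 0 := by
  rw [Fintype.linearIndependent_iff]
  constructor
  · intro h a b c habc
    have := h ![a, b, c] (by simpa [Fin.sum_univ_three] using habc)
    exact ⟨this 0, this 1, this 2⟩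
  · intro h g hg i
    obtain ⟨h0, h1, h2⟩ := h (g 0) (g 1) (g 2) (by simpa [Fin.sum_univ_three] using hg)
    fin_cases i <;> assumption

lemma exists_eq_combination {p y z : Fin 3 → F3} (h : LinearIndependent F3 ![p, y, z])
    (x : Fin 3 → F3) : ∃ a b c : F3, x = a • p + b • y + c • z := by
  have hspan := h.span_eq_top_of_card_eq_finrank' (by simp)
  have hx : x ∈ Submodule.span F3 (Set.range ![p, y, z]) := hspan ▸ Submodule.mem_top
  obtain ⟨c, rfl⟩ := (Submodule.mem_span_range_iff_exists_fun F3).1 hx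
  exact ⟨c 0, c 1, c 2, by simp [Fin.sum_univ_three]⟩

lemma eq_zero_of_polar_eq_zero (q : QuadraticForm F3 (Fin 3 → F3))
    (hq : ∀ x : Fin 3 → F3, (∀ y, q (x + y) - q x - q y = 0) → x = 0)
    {p y z x : Fin 3 → F3} (h : LinearIndependent F3 ![p, y, z])
    (hp : QuadraticMap.polar q x p = 0) (hy : QuadraticMap.polar q x y = 0)
    (hz : QuadraticMap.polar q x z = 0) : x = 0 := by
  refine hq x fun w ↦ ?_
  change QuadraticMap.polar q x w = 0
  obtain ⟨a, b, c, rfl⟩ := exists_eq_combination h w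
  simp [QuadraticMap.polar_add_right, QuadraticMap.polar_smul_right, hp, hy, hz]

lemma polar_self_of_map_eq_zero (q : QuadraticForm F3 (Fin 3 → F3)) {p : Fin 3 → F3}
    (hp : q p = 0) : QuadraticMap.polar q p p = 0 := by
  simp [QuadraticMap.polar_self, hp]

lemma polar_ne_zero (q : QuadraticForm F3 (Fin 3 → F3))
    (hq : ∀ x : Fin 3 → F3, (∀ y, q (x + y) - q x - q y = 0) → x = 0)
    {p y : Fin 3 → F3} (h : LinearIndependent F3 ![p, y]) (hp : q p = 0) (hy : q y = 0) :
    QuadraticMap.polar q p y ≠ 0 := by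
  intro hpy
  have hyp : QuadraticMap.polar q y p = 0 := by rwa [QuadraticMap.polar_comm]
  obtain ⟨w, hw⟩ := exists_linearIndependent_snoc_of_lt_finrank (R := F3) (M := Fin 3 → F3)
    (n := 2) (v := ![p, y]) h (by simp)
  have hw' : LinearIndependent F3 ![p, y, w] := by
    have hsnoc : (Fin.snoc ![p, y] w : Fin 3 → Fin 3 → F3) = ![p, y, w] := by
      ext i
      fin_cases i <;> rfl
    exact hsnoc ▸ hw
  have hpp := polar_self_of_map_eq_zero q hp
  have hyy := polar_self_of_map_eq_zero q hy
  have hx : QuadraticMap.polar q y w • p + (-QuadraticMap.polar q p w) • y = 0 := by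
    apply eq_zero_of_polar_eq_zero q hq hw' <;>
      simp only [QuadraticMap.polar_add_left, QuadraticMap.polar_smul_left, hpp, hyy, hpy, hyp,
        smul_eq_mul] <;> ring
  have hpw := (LinearIndependent.pair_iff.1 h _ _ hx).2
  exact h.ne_zero 0 (eq_zero_of_polar_eq_zero q hq hw' hpp hpy (neg_eq_zero.1 hpw))

/-- Two independent singular vectors `p`, `y` extend to a basis `p`, `y`, `z` in which
`q` has the form `a b e + c² d`. -/
lemma exists_normal_form (q : QuadraticForm F3 (Fin 3 → F3))
    (hq : ∀ x : Fin 3 → F3, (∀ y, q (x + y) - q x - q y = 0) → x = 0)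
    {p y : Fin 3 → F3} (h : LinearIndependent F3 ![p, y]) (hp : q p = 0) (hy : q y = 0) :
    ∃ (z : Fin 3 → F3) (e d : F3), e ≠ 0 ∧ d ≠ 0 ∧ LinearIndependent F3 ![p, y, z] ∧
      ∀ a b c : F3, q (a • p + b • y + c • z) = a * b * e + c * c * d := by
  have he := polar_ne_zero q hq h hp hy
  have hpp := polar_self_of_map_eq_zero q hp
  have hyy := polar_self_of_map_eq_zero q hy
  obtain ⟨z, hz, hz0⟩ := (Submodule.ne_bot_iff _).1 (LinearMap.ker_ne_bot_of_finrank_lt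
    (f := (q.polarBilin p).prod (q.polarBilin y)) (by simp))
  have hpz : QuadraticMap.polar q p z = 0 := (Prod.ext_iff.1 (LinearMap.mem_ker.1 hz)).1
  have hyz : QuadraticMap.polar q y z = 0 := (Prod.ext_iff.1 (LinearMap.mem_ker.1 hz)).2
  have hli : LinearIndependent F3 ![p, y, z] := by
    refine linearIndependent_triple_iff.2 fun a b c habc ↦ ?_
    have hb := congrArg (QuadraticMap.polar q p) habc
    have ha := congrArg (QuadraticMap.polar q y) habc
    simp [QuadraticMap.polar_add_right, QuadraticMap.polar_smul_right, hpp, hpz, he] at hb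
    simp [QuadraticMap.polar_add_right, QuadraticMap.polar_smul_right, hyy, hyz,
      QuadraticMap.polar_comm q y p, he] at ha
    simpa [ha, hb, hz0] using habc
  refine ⟨z, QuadraticMap.polar q p y, q z, he, fun hqz ↦ hz0 ?_, hli, fun a b c ↦ ?_⟩
  · exact eq_zero_of_polar_eq_zero q hq hli (by rwa [QuadraticMap.polar_comm])
      (by rwa [QuadraticMap.polar_comm]) (polar_self_of_map_eq_zero q hqz)
  · have := map_smul_add_smul q (a • p + b • y) z 1 c
    rw [one_smul] at this
    rw [this, map_smul_add_smul, hp, hy, QuadraticMap.polar_add_left,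
      QuadraticMap.polar_smul_left, QuadraticMap.polar_smul_left, hpz, hyz]
    simp only [smul_eq_mul]
    ring

/-- Let `C` be a conic in `PG(2,3)` and let `P, Y ∈ C` with `Y ≠ P`.
Then the line through `P` and `Y` contains exactly one internal point of `C`. -/
theorem line_through_two_conic_points_has_unique_internal_point :
    ∀ C : Set PG2, IsConic2 C → ∀ P Y : PG2, P ∈ C → Y ∈ C → Y ≠ P →
      ∀ L : Set PG2, IsLine2 L → P ∈ L → Y ∈ L →
        ∃! Q : PG2, Q ∈ L ∧ IsInternal2 Q C := by
  rintro C ⟨q, hq, rfl⟩ P Y hP hY hYP L ⟨W, hW, rfl⟩ hPL hYL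
  induction P using Projectivization.ind with
  | h p hp0 =>
  induction Y using Projectivization.ind with
  | h y hy0 =>
  rw [mk_mem_conic_iff] at hP hY
  rw [mk_mem_line_iff] at hPL hYL
  have hli : LinearIndependent F3 ![p, y] := by
    rw [LinearIndependent.pair_iff' hp0]
    intro a ha
    exact hYP ((Projectivization.mk_eq_mk_iff' F3 _ _ _ _).2 ⟨a, ha⟩)
  have hWspan : W = Submodule.span F3 {p, y} := by
    symm
    apply Submodule.eq_of_le_of_finrank_eq
    · exact Submodule.span_le.2 (by simp [Set.insert_subset_iff, hPL, hYL])
    · have := finrank_span_eq_card hli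
      rw [Matrix.range_cons_cons_empty, Fintype.card_fin] at this
      rw [this, hW]
  obtain ⟨z, e, d, he, hd, hli3, hnf⟩ := exists_normal_form q hq hli hP hY
  have hq_eq {x : Fin 3 → F3} (a b c : F3) (hx : x = a • p + b • y + c • z) :
      q x = a * b * e + c * c * d := hx ▸ hnf a b c
  have hpolar {x x' : Fin 3 → F3} (a b c a' b' c' : F3) (hx : x = a • p + b • y + c • z)
      (hx' : x' = a' • p + b' • y + c' • z) :
      QuadraticMap.polar q x x' = (a * b' + a' * b) * e + 2 * c * c' * d := by
    rw [QuadraticMap.polar, hq_eq a b c hx, hq_eq a' b' c' hx',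
      hq_eq (a + a') (b + b') (c + c') (by rw [hx, hx']; module)]
    ring
  have hqz : q z ≠ 0 := by
    rw [hq_eq 0 0 1 (by module)]
    simpa using hd
  have hee : e * e = 1 := by
    clear * - he
    revert e
    decide
  set u := p + (-(d * e)) • y with hu
  set v := p + (d * e) • y with hv
  set t := u + z with ht
  have hqu : q u = -d := by
    rw [hq_eq 1 (-(d * e)) 0 (by module)]
    linear_combination (-d) * hee
  have hqv : q v = d := by
    rw [hq_eq 1 (d * e) 0 (by module)]
    linear_combination d * hee
  have hqt : q t = 0 := by
    rw [hq_eq 1 (-(d * e)) 1 (by module)]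
    linear_combination (-d) * hee
  have hu0 : u ≠ 0 := by
    rintro h
    simp [h, eq_comm, hd] at hqu
  have ht0 : t ≠ 0 := by
    intro h
    have := linearIndependent_triple_iff.1 hli3 1 (-(d * e)) 1 (by rw [← h]; module)
    exact one_ne_zero this.1
  refine ⟨Projectivization.mk F3 u hu0, ⟨?_, ?_⟩, ?_⟩
  · rw [mk_mem_line_iff]
    exact W.add_mem hPL (W.smul_mem _ hYL)
  · refine isInternal2_mk q hu0 (by simpa [hqu] using hd) fun x hx hux ↦ ?_
    obtain ⟨a, b, c, hxe⟩ := exists_eq_combination hli3 x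
    rw [hpolar 1 (-(d * e)) 0 a b c (by module) hxe] at hux
    rw [hq_eq a b c hxe] at hx
    have habc : a = 0 ∧ b = 0 ∧ c = 0 := by
      clear * - hx hux he hd
      revert a b c d e
      decide
    simp [hxe, habc]
  · rintro X ⟨hXL, hXint⟩
    induction X using Projectivization.ind with
    | h x hx0 =>
    rw [mk_mem_line_iff, hWspan] at hXL
    obtain ⟨a, b, rfl⟩ := Submodule.mem_span_pair.1 hXL
    have hnot {w s : Fin 3 → F3} (hs0 : s ≠ 0) (hqs : q s = 0) (hqw : q w ≠ 0)
        (hws : QuadraticMap.polar q w s = 0) :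
        a • p + b • y ∉ Submodule.span F3 {w, s} := fun hmem ↦
      hXint _ (isTangent2_span_pair q hs0 hqs hqw hws) ((mk_mem_line_iff _ hx0).2 hmem)
    have hb : b ≠ 0 := by
      rintro rfl
      refine hnot hp0 hP hqz ?_ (Submodule.mem_span_pair.2 ⟨0, a, by module⟩)
      rw [hpolar 0 0 1 1 0 0 (by module) (by module)]
      ring
    have ha : a ≠ 0 := by
      rintro rfl
      refine hnot hy0 hY hqz ?_ (Submodule.mem_span_pair.2 ⟨0, b, by module⟩)
      rw [hpolar 0 0 1 0 1 0 (by module) (by module)]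
      ring
    have hbv : b ≠ a * (d * e) := by
      rintro rfl
      refine hnot ht0 hqt (hqv ▸ hd) ?_ (Submodule.mem_span_pair.2 ⟨a, 0, by rw [hv]; module⟩)
      rw [hpolar 1 (d * e) 0 1 (-(d * e)) 1 (by module) (by module)]
      ring
    have hbu : b = a * -(d * e) := by
      clear * - ha hb hd he hbv
      revert a b d e
      decide
    refine (Projectivization.mk_eq_mk_iff' F3 _ _ _ _).2 ⟨a, ?_⟩
    rw [hu, hbu]
    module
end

section
/- For every (p, q, r, s) ∈ F⁴ with p + q + r + s = 0, there exists a linear automorphism of F⁶ whose induced collineation of PG(5,3) maps the set ⋃_{k ∈ F ∪ {∞}} Δ_{k,0} (the Veronese surface minus the point P = [(1,0,0,0,0,0)]) onto Δ_{0,p} ∪ Δ_{1,q} ∪ Δ_{2,r} ∪ Δ_{∞,s}. -/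
/-- The shear of `F⁶` adding the linear form `α x₃ + β x₄ + γ x₅` to the coordinate `x₀`. -/
def quadraticShear (α β γ : F3) : (Fin 6 → F3) ≃ₗ[F3] (Fin 6 → F3) :=
  LinearEquiv.transvection (v := Pi.single 0 1)
    (f := α • LinearMap.proj 3 + β • LinearMap.proj 4 + γ • LinearMap.proj 5) (by simp)

theorem quadraticShear_apply (α β γ x₀ x₁ x₂ x₃ x₄ x₅ : F3) :
    quadraticShear α β γ ![x₀, x₁, x₂, x₃, x₄, x₅] =
      ![x₀ + (α * x₃ + β * x₄ + γ * x₅), x₁, x₂, x₃, x₄, x₅] := by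
  funext i
  fin_cases i <;> simp [quadraticShear, LinearMap.transvection.apply]

theorem isRep6_map_iff (g : (Fin 6 → F3) ≃ₗ[F3] (Fin 6 → F3)) (v : Fin 6 → F3) (Q : PG5) :
    IsRep6 (g v) Q ↔
      ∃ R, IsRep6 v R ∧ Projectivization.map g.toLinearMap g.injective R = Q := by
  constructor
  · rintro ⟨hv, rfl⟩
    have hv' : v ≠ 0 := fun h => hv (by simp [h])
    exact ⟨_, ⟨hv', rfl⟩, rfl⟩
  · rintro ⟨_, ⟨hv, rfl⟩, rfl⟩
    exact ⟨g.map_ne_zero_iff.2 hv, rfl⟩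

/-- A shear acts on `Δ k 0` through the value of its quadratic form at `(a_k, b_k)`. -/
theorem image_quadraticShear_Δ (α β γ j : F3) (k : Option F3)
    (h : α * (abk k).1 ^ 2 + β * ((abk k).1 * (abk k).2) + γ * (abk k).2 ^ 2 = j) :
    Projectivization.map (quadraticShear α β γ).toLinearMap (quadraticShear α β γ).injective ''
      Δ k 0 = Δ k j := by
  ext Q
  have hrep (u : F3) := isRep6_map_iff (quadraticShear α β γ)
    ![u ^ 2 + 0, u * (abk k).1, u * (abk k).2,
      (abk k).1 ^ 2, (abk k).1 * (abk k).2, (abk k).2 ^ 2] Q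
  simp only [quadraticShear_apply, h, add_zero] at hrep
  simp only [Δ, Set.mem_image, Set.mem_ofPred_eq, hrep, add_zero]
  exact ⟨fun ⟨R, ⟨u, hu⟩, hR⟩ => ⟨u, R, hu, hR⟩, fun ⟨u, R, hu, hR⟩ => ⟨R, ⟨u, hu⟩, hR⟩⟩

theorem iUnion_option_F3 {X : Type*} (S : Option F3 → Set X) :
    ⋃ k, S k = S (some 0) ∪ S (some 1) ∪ S (some 2) ∪ S none := by
  have hk : ∀ k : Option F3, k = some 0 ∨ k = some 1 ∨ k = some 2 ∨ k = none := by decide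
  ext x
  simp only [Set.mem_iUnion, Set.mem_union]
  constructor
  · rintro ⟨k, hx⟩
    rcases hk k with rfl | rfl | rfl | rfl <;> simp [hx]
  · rintro (((hx | hx) | hx) | hx) <;> exact ⟨_, hx⟩

/-- For every `(p,q,r,s) ∈ F⁴` with `p + q + r + s = 0`, some linear
automorphism of `F⁶` induces a collineation of `PG(5,3)` mapping the set
`⋃ₖ Δ_{k,0}` (the Veronese surface minus the point `P`) onto
`Δ_{0,p} ∪ Δ_{1,q} ∪ Δ_{2,r} ∪ Δ_{∞,s}`. -/
theorem coset_zero_equivalent_to_punctured_Veronese :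
    ∀ p q r s : F3, p + q + r + s = 0 →
      ∃ g : (Fin 6 → F3) ≃ₗ[F3] (Fin 6 → F3),
        Projectivization.map g.toLinearMap g.injective '' (⋃ k : Option F3, Δ k 0) =
          Δ (some 0) p ∪ Δ (some 1) q ∪ Δ (some 2) r ∪ Δ none s := by
  intro p q r s h
  refine ⟨quadraticShear p (q - p - s) s, ?_⟩
  rw [Set.image_iUnion, iUnion_option_F3, image_quadraticShear_Δ _ _ _ p,
    image_quadraticShear_Δ _ _ _ q, image_quadraticShear_Δ _ _ _ r,
    image_quadraticShear_Δ _ _ _ s]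
  · simp [abk]
  · revert p q r s
    decide
  · simp only [abk]
    ring
  · simp [abk]
end

section
/- For every (p, q, r, s) ∈ F⁴ with p + q + r + s = 1, there exists a linear automorphism of F⁶ whose induced collineation of PG(5,3) maps the set K = ⋃_{k ∈ F ∪ {∞}} Δ_{k,1} onto Δ_{0,p} ∪ Δ_{1,q} ∪ Δ_{2,r} ∪ Δ_{∞,s}. -/
/-- The shear of `F⁶` adding `α v₃ + β v₄ + γ v₅` to the zeroth coordinate. -/
def shear (α β γ : F3) : (Fin 6 → F3) ≃ₗ[F3] (Fin 6 → F3) where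
  toFun v := ![v 0 + (α * v 3 + β * v 4 + γ * v 5), v 1, v 2, v 3, v 4, v 5]
  invFun v := ![v 0 - (α * v 3 + β * v 4 + γ * v 5), v 1, v 2, v 3, v 4, v 5]
  map_add' v w := by ext i; fin_cases i <;> simp; ring
  map_smul' c v := by ext i; fin_cases i <;> simp; ring
  left_inv v := by ext i; fin_cases i <;> simp
  right_inv v := by ext i; fin_cases i <;> simp

theorem image_setOf_isRep6 (g : (Fin 6 → F3) ≃ₗ[F3] (Fin 6 → F3)) (f : F3 → Fin 6 → F3) :
    Projectivization.map g.toLinearMap g.injective '' {Q | ∃ u, IsRep6 (f u) Q} =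
      {Q | ∃ u, IsRep6 (g (f u)) Q} := by
  ext Q
  constructor
  · rintro ⟨_, ⟨u, hu, rfl⟩, rfl⟩
    exact ⟨u, g.map_ne_zero_iff.2 hu, rfl⟩
  · rintro ⟨u, hu, rfl⟩
    exact ⟨_, ⟨u, g.map_ne_zero_iff.1 hu, rfl⟩, rfl⟩

/-- A shear adds to `j` the value of the binary quadratic form `(α, β, γ)` at `(a_k, b_k)`. -/
theorem shear_image_Δ (α β γ : F3) (k : Option F3) (j : F3) :
    Projectivization.map (shear α β γ).toLinearMap (shear α β γ).injective '' Δ k j =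
      Δ k (j + (α * (abk k).1 ^ 2 + β * ((abk k).1 * (abk k).2) + γ * (abk k).2 ^ 2)) := by
  unfold Δ
  rw [image_setOf_isRep6]
  simp [shear, add_assoc]

/-- For every `(p,q,r,s) ∈ F⁴` with `p + q + r + s = 1`, some linear
automorphism of `F⁶` induces a collineation of `PG(5,3)` mapping the set
`K = ⋃ₖ Δ_{k,1}` onto `Δ_{0,p} ∪ Δ_{1,q} ∪ Δ_{2,r} ∪ Δ_{∞,s}`. -/
theorem coset_one_equivalent_to_K :
    ∀ p q r s : F3, p + q + r + s = 1 →
      ∃ g : (Fin 6 → F3) ≃ₗ[F3] (Fin 6 → F3),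
        Projectivization.map g.toLinearMap g.injective '' (⋃ k : Option F3, Δ k 1) =
          Δ (some 0) p ∪ Δ (some 1) q ∪ Δ (some 2) r ∪ Δ none s := by
  intro p q r s h
  refine ⟨shear (p - 1) (q - p - s + 1) (s - 1), ?_⟩
  have h3 : (3 : F3) = 0 := rfl
  rw [Set.image_iUnion, iUnion_option_F3]
  simp only [shear_image_Δ, abk]
  congr 1
  · congr 1
    · congr 2 <;> ring
    · congr 1
      linear_combination (-1 : F3) * h + (q + s - 1) * h3
  · congr 1
    ring
end

section
/- For every (p, q, r, s) ∈ F⁴, the set Δ_{0,p} ∪ Δ_{1,q} ∪ Δ_{2,r} ∪ Δ_{∞,s} ⊆ PG(5,3) has exactly 12 elements (the four sets Δ_{0,p}, Δ_{1,q}, Δ_{2,r}, Δ_{∞,s} are pairwise disjoint and each has exactly 3 elements). -/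
/-- The parametrizing vector of `Δ k j`. -/
def deltaVec (k : Option F3) (j u : F3) : Fin 6 → F3 :=
  ![u ^ 2 + j, u * (abk k).1, u * (abk k).2,
    (abk k).1 ^ 2, (abk k).1 * (abk k).2, (abk k).2 ^ 2]

/-- The last three coordinates of `deltaVec` determine the scalar and the index `k`. -/
lemma smul_abk_sq_inj : ∀ (k l : Option F3) (c : F3),
    c * (abk l).1 ^ 2 = (abk k).1 ^ 2 → c * ((abk l).1 * (abk l).2) = (abk k).1 * (abk k).2 →
    c * (abk l).2 ^ 2 = (abk k).2 ^ 2 → c = 1 ∧ k = l := by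
  decide

lemma mul_abk_inj : ∀ (k : Option F3) (u v : F3),
    v * (abk k).1 = u * (abk k).1 → v * (abk k).2 = u * (abk k).2 → u = v := by
  decide

lemma abk_sq_ne_zero : ∀ k : Option F3, (abk k).1 ^ 2 ≠ 0 ∨ (abk k).2 ^ 2 ≠ 0 := by
  decide

lemma deltaVec_ne_zero (k : Option F3) (j u : F3) : deltaVec k j u ≠ 0 := fun h =>
  (abk_sq_ne_zero k).elim (fun h₁ => h₁ (congrFun h 3)) (fun h₂ => h₂ (congrFun h 5))

/-- The parametrization of `Δ k j` by `F`. -/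
def deltaPt (k : Option F3) (j u : F3) : PG5 :=
  Projectivization.mk F3 (deltaVec k j u) (deltaVec_ne_zero k j u)

lemma delta_eq_range (k : Option F3) (j : F3) : Δ k j = Set.range (deltaPt k j) := by
  ext Q
  exact ⟨fun ⟨u, _, h⟩ => ⟨u, h⟩, fun ⟨u, h⟩ => ⟨u, deltaVec_ne_zero k j u, h⟩⟩

lemma deltaPt_inj {k l : Option F3} {i j u v : F3} (h : deltaPt k i u = deltaPt l j v) :
    k = l ∧ u = v := by
  obtain ⟨c, hc⟩ := (Projectivization.mk_eq_mk_iff' F3 _ _ _ _).1 h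
  obtain ⟨rfl, rfl⟩ := smul_abk_sq_inj k l c (congrFun hc 3) (congrFun hc 4) (congrFun hc 5)
  rw [one_smul] at hc
  exact ⟨rfl, mul_abk_inj k u v (congrFun hc 1) (congrFun hc 2)⟩

lemma ncard_delta (k : Option F3) (j : F3) : (Δ k j).ncard = 3 := by
  rw [delta_eq_range, ← Set.image_univ,
    Set.ncard_image_of_injective _ fun _ _ h => (deltaPt_inj h).2, Set.ncard_univ, Nat.card_zmod]

lemma finite_delta (k : Option F3) (j : F3) : (Δ k j).Finite :=
  Set.finite_of_ncard_pos (by simp [ncard_delta])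

lemma disjoint_delta {k l : Option F3} (hkl : k ≠ l) (i j : F3) : Disjoint (Δ k i) (Δ l j) := by
  rw [delta_eq_range, delta_eq_range, Set.disjoint_left]
  rintro _ ⟨u, rfl⟩ ⟨v, h⟩
  exact hkl (deltaPt_inj h).1.symm

/-- For every `(p,q,r,s) ∈ F⁴`, the set
`Δ_{0,p} ∪ Δ_{1,q} ∪ Δ_{2,r} ∪ Δ_{∞,s}` has exactly 12 elements; indeed the four sets
are pairwise disjoint and each has exactly 3 elements. -/
theorem union_of_four_deltas_has_twelve_points :
    ∀ p q r s : F3,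
      (Δ (some 0) p ∪ Δ (some 1) q ∪ Δ (some 2) r ∪ Δ none s).ncard = 12 ∧
      (Δ (some 0) p).ncard = 3 ∧ (Δ (some 1) q).ncard = 3 ∧
      (Δ (some 2) r).ncard = 3 ∧ (Δ none s).ncard = 3 ∧
      (∀ i j : Fin 4, i ≠ j →
        Disjoint (![Δ (some 0) p, Δ (some 1) q, Δ (some 2) r, Δ none s] i)
          (![Δ (some 0) p, Δ (some 1) q, Δ (some 2) r, Δ none s] j)) := by
  intro p q r s
  refine ⟨?_, ncard_delta _ _, ncard_delta _ _, ncard_delta _ _, ncard_delta _ _, ?_⟩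
  · have h₁ := (finite_delta (some 0) p).union (finite_delta (some 1) q)
    have h₂ := h₁.union (finite_delta (some 2) r)
    rw [Set.ncard_union_eq _ h₂ (finite_delta _ _), Set.ncard_union_eq _ h₁ (finite_delta _ _),
      Set.ncard_union_eq _ (finite_delta _ _) (finite_delta _ _)]
    · simp only [ncard_delta]
    all_goals
      repeat rw [Set.disjoint_union_left]
      and_intros <;> exact disjoint_delta (by decide) _ _
  · intro i j hij
    fin_cases i <;> fin_cases j <;>
      first
      | exact absurd rfl hij
      | exact disjoint_delta (by decide) _ _
end

section
/- There is no linear automorphism of F⁶ whose induced collineation of PG(5,3) maps V \ {P} onto K, where V is the Veronese surface, P = [(1,0,0,0,0,0)], and K is the 12-cap. (Indeed, V \ {P} contains four distinct coplanar points, whereas K does not.) -/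
/-- The Veronese surface `V ⊆ PG(5,3)`: the image of the Veronese map
`[(x₀,x₁,x₂)] ↦ [(x₀², x₀x₁, x₀x₂, x₁², x₁x₂, x₂²)]`. -/
def Vset : Set PG5 :=
  {Q | ∃ x₀ x₁ x₂ : F3,
    IsRep6 ![x₀ ^ 2, x₀ * x₁, x₀ * x₂, x₁ ^ 2, x₁ * x₂, x₂ ^ 2] Q}

/-- Representatives of the four points of `PG(1,3)`. -/
def direction : Fin 4 → F3 × F3 := ![(1, 0), (0, 1), (1, 1), (1, 2)]

/-- A normalized representative of a point of `K`, indexed by the free parameter `x` and the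
direction `d`. -/
def capVector (x : F3) (d : Fin 4) : Fin 6 → F3 :=
  ![x ^ 2 + 1, x * (direction d).1, x * (direction d).2, (direction d).1 ^ 2,
    (direction d).1 * (direction d).2, (direction d).2 ^ 2]

lemma exists_capVector_eq : ∀ x₀ x₁ x₂ : F3, (x₁, x₂) ≠ (0, 0) →
    ∃ x d, ![x₀ ^ 2 + 1, x₀ * x₁, x₀ * x₂, x₁ ^ 2, x₁ * x₂, x₂ ^ 2] = capVector x d := by
  decide +kernel

/-- The points of `V` on the conic `x₀ = 0`. -/
def conicVector (d : Fin 4) : Fin 6 → F3 :=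
  ![0, 0, 0, (direction d).1 ^ 2, (direction d).1 * (direction d).2, (direction d).2 ^ 2]

lemma conicVector_ne_zero : ∀ d, conicVector d ≠ 0 := by decide

lemma sum_conicVector : ∑ d, conicVector d = 0 := by decide

lemma eq_of_smul_conicVector_eq : ∀ (a b : F3) (i j : Fin 4), a ≠ 0 →
    a • conicVector i = b • conicVector j → i = j := by
  decide +kernel

lemma mk_conicVector_mem (d : Fin 4) :
    Projectivization.mk F3 (conicVector d) (conicVector_ne_zero d) ∈ Vset \ {Ppt} := by
  refine ⟨⟨0, (direction d).1, (direction d).2, ?_⟩, fun h => ?_⟩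
  · have h : ![(0 : F3) ^ 2, 0 * (direction d).1, 0 * (direction d).2, (direction d).1 ^ 2,
        (direction d).1 * (direction d).2, (direction d).2 ^ 2] = conicVector d := by
      simp [conicVector]
    exact ⟨h ▸ conicVector_ne_zero d, by simp only [h]⟩
  · obtain ⟨a, ha⟩ := (Projectivization.mk_eq_mk_iff' F3 _ _ _ _).1 h
    clear h
    revert d a
    decide +kernel

set_option synthInstance.maxSize 2000 in
/-- Four distinct points of `K` satisfy no linear relation with all coefficients nonzero;
the hypotheses list the coordinates of such a relation, last ones first. -/
lemma capVector_relation : ∀ d₀ d₁ d₂ d₃ : Fin 4, ∀ a₀ a₁ a₂ a₃ : F3,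
    a₀ ≠ 0 → a₁ ≠ 0 → a₂ ≠ 0 → a₃ ≠ 0 →
    a₀ * (direction d₀).1 ^ 2 + a₁ * (direction d₁).1 ^ 2 + a₂ * (direction d₂).1 ^ 2 +
      a₃ * (direction d₃).1 ^ 2 = 0 →
    a₀ * (direction d₀).2 ^ 2 + a₁ * (direction d₁).2 ^ 2 + a₂ * (direction d₂).2 ^ 2 +
      a₃ * (direction d₃).2 ^ 2 = 0 →
    a₀ * ((direction d₀).1 * (direction d₀).2) + a₁ * ((direction d₁).1 * (direction d₁).2) +
      a₂ * ((direction d₂).1 * (direction d₂).2) +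
      a₃ * ((direction d₃).1 * (direction d₃).2) = 0 →
    ∀ x₀ x₁ x₂ x₃ : F3,
    a₀ * (x₀ * (direction d₀).1) + a₁ * (x₁ * (direction d₁).1) +
      a₂ * (x₂ * (direction d₂).1) + a₃ * (x₃ * (direction d₃).1) = 0 →
    a₀ * (x₀ * (direction d₀).2) + a₁ * (x₁ * (direction d₁).2) +
      a₂ * (x₂ * (direction d₂).2) + a₃ * (x₃ * (direction d₃).2) = 0 →
    a₀ * (x₀ ^ 2 + 1) + a₁ * (x₁ ^ 2 + 1) + a₂ * (x₂ ^ 2 + 1) + a₃ * (x₃ ^ 2 + 1) = 0 →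
    (x₀ = x₁ ∧ d₀ = d₁) ∨ (x₀ = x₂ ∧ d₀ = d₂) ∨ (x₀ = x₃ ∧ d₀ = d₃) ∨
      (x₁ = x₂ ∧ d₁ = d₂) ∨ (x₁ = x₃ ∧ d₁ = d₃) ∨ (x₂ = x₃ ∧ d₂ = d₃) := by
  decide +kernel

lemma exists_eq_of_sum_smul_capVector (a x : Fin 4 → F3) (d : Fin 4 → Fin 4)
    (ha : ∀ i, a i ≠ 0) (h : ∑ i, a i • capVector (x i) (d i) = 0) :
    ∃ i j, i ≠ j ∧ x i = x j ∧ d i = d j := by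
  have hc (k : Fin 6) := congrFun h k
  simp only [Fin.sum_univ_four, Pi.add_apply, Pi.smul_apply, smul_eq_mul, Pi.zero_apply] at hc
  rcases capVector_relation (d 0) (d 1) (d 2) (d 3) (a 0) (a 1) (a 2) (a 3) (ha 0) (ha 1) (ha 2)
    (ha 3) (hc 3) (hc 5) (hc 4) (x 0) (x 1) (x 2) (x 3) (hc 1) (hc 2) (hc 0) with
    h | h | h | h | h | h
  exacts [⟨0, 1, by decide, h⟩, ⟨0, 2, by decide, h⟩, ⟨0, 3, by decide, h⟩,
    ⟨1, 2, by decide, h⟩, ⟨1, 3, by decide, h⟩, ⟨2, 3, by decide, h⟩]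

/-- There is no linear automorphism of `F⁶` whose induced collineation
of `PG(5,3)` maps `V \ {P}` onto `K`. -/
theorem no_collineation_maps_punctured_Veronese_to_K :
    ¬∃ g : (Fin 6 → F3) ≃ₗ[F3] (Fin 6 → F3),
      Projectivization.map g.toLinearMap g.injective '' (Vset \ {Ppt}) = Kset := by
  rintro ⟨g, hg⟩
  have key (i : Fin 4) : ∃ (a : F3) (x : F3) (d : Fin 4), a ≠ 0 ∧ a • capVector x d = g (conicVector i) := by
    obtain ⟨x₀, x₁, x₂, hx, hv, he⟩ := hg.subset (Set.mem_image_of_mem _ (mk_conicVector_mem i))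
    obtain ⟨x, d, hxd⟩ := exists_capVector_eq x₀ x₁ x₂ hx
    rw [Projectivization.map_mk, eq_comm, Projectivization.mk_eq_mk_iff', hxd] at he
    obtain ⟨a, ha⟩ := he
    refine ⟨a, x, d, ?_, ha⟩
    rintro rfl
    rw [zero_smul] at ha
    exact conicVector_ne_zero i (g.map_eq_zero_iff.1 ha.symm)
  choose a x d ha hg' using key
  obtain ⟨i, j, hij, hx, hd⟩ := exists_eq_of_sum_smul_capVector a x d ha (by
    simp_rw [hg', ← map_sum, sum_conicVector, map_zero])
  refine hij (eq_of_smul_conicVector_eq (a j) (a i) i j (ha j) (g.injective ?_))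
  rw [map_smul, map_smul, ← hg', ← hg', hx, hd, smul_comm]
end
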